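/- arXiv:2309.00574 — 2 statements merged into one kernel-verified Lean document; each statement's English description precedes it below -/
import Mathlib

section
/- Let 0 < p < 1. For every κ > 0 there exist constants C > 0 and σ > 0, depending only on A, k, m, n, p and κ, such that for every global weak solution u of the problem and every R > 0 with mes{(x,t) ∈ Q_R^κ : u(x,t) ≠ 0} > 0, one has F_κ( σ R^{−(n+κ)} ∫_{Q_R^κ} |u| dx dt ) ≥ C R, where F_κ(s) = ( ∫_s^∞ ζ^{1/k−1} f(ζ)^{−1/k} dζ )^{1/κ} + ∫_s^∞ ζ^{p/m−1} f(ζ)^{−1/m} dζ. -/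
open MeasureTheory Real Set Filter

noncomputable section

/-- The spatial domain `ℝⁿ`. -/
abbrev Spc (n : ℕ) := EuclideanSpace ℝ (Fin n)

/-- The open ball `B_r` in `ℝⁿ` of radius `r` centered at `0`. -/
def ball0 (n : ℕ) (r : ℝ) : Set (Spc n) := Metric.ball 0 r

/-- The cylinder `Q_r^κ = B_r × (0, r^κ)`. -/
def cyl (n : ℕ) (r κ : ℝ) : Set (Spc n × ℝ) := ball0 n r ×ˢ Ioo 0 (r ^ κ)

/-- The half-space `ℝ^{n+1}_+ = ℝⁿ × (0, ∞)`. -/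
def halfSp (n : ℕ) : Set (Spc n × ℝ) := {z | 0 < z.2}

/-- The (finite) set of multi-indices `α` with `|α| = m`. -/
def mIdx (n m : ℕ) : Finset (Fin n → ℕ) :=
  (Fintype.piFinset fun _ : Fin n => Finset.range (m + 1)).filter fun α => ∑ i, α i = m

/-- Spatial partial derivative `∂/∂x_i`. -/
def spDeriv (n : ℕ) (i : Fin n) (φ : Spc n × ℝ → ℝ) : Spc n × ℝ → ℝ :=
  fun z => deriv (fun s : ℝ => φ (z.1 + s • EuclideanSpace.single i (1 : ℝ), z.2)) 0

/-- Time derivative `∂/∂t`. -/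
def tDeriv (n : ℕ) (φ : Spc n × ℝ → ℝ) : Spc n × ℝ → ℝ :=
  fun z => deriv (fun s : ℝ => φ (z.1, s)) z.2

/-- Multi-index spatial derivative `∂^α`. -/
def mDeriv (n : ℕ) (α : Fin n → ℕ) (φ : Spc n × ℝ → ℝ) : Spc n × ℝ → ℝ :=
  (List.finRange n).foldr (fun i ψ => (spDeriv n i)^[α i] ψ) φ

/-- Caratheodory conditions and the growth bound `|a_α(x,t,ζ)| ≤ A |ζ|^p` for the
coefficients of the operator `L`. -/
def GoodCoeffs (n m : ℕ) (A p : ℝ) (a : (Fin n → ℕ) → Spc n × ℝ → ℝ → ℝ) : Prop :=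
  ∀ α ∈ mIdx n m,
    (∀ ζ : ℝ, Measurable fun z => a α z ζ) ∧
    (∀ᵐ z ∂(volume.restrict (halfSp n)), Continuous fun ζ => a α z ζ) ∧
    (∀ᵐ z ∂(volume.restrict (halfSp n)), ∀ ζ : ℝ, |a α z ζ| ≤ A * |ζ| ^ p)

/-- The standing conditions on `f`: `ζ ↦ f ζ` and `ζ ↦ f (ζ^{1/p})` are nondecreasing
and convex on `[0,∞)`, and `f` is positive on `(0,∞)`. -/
def GoodF (p : ℝ) (f : ℝ → ℝ) : Prop :=
  MonotoneOn f (Ici 0) ∧ ConvexOn ℝ (Ici 0) f ∧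
  MonotoneOn (fun ζ => f (ζ ^ (1 / p))) (Ici 0) ∧
  ConvexOn ℝ (Ici 0) (fun ζ => f (ζ ^ (1 / p))) ∧
  ∀ ζ : ℝ, 0 < ζ → 0 < f ζ

/-- Condition (1.4): `∫_1^∞ ζ^{1/k - 1} f(ζ)^{-1/k} dζ < ∞`. -/
def Cond14 (k : ℕ) (f : ℝ → ℝ) : Prop :=
  IntegrableOn (fun ζ : ℝ => ζ ^ ((k : ℝ)⁻¹ - 1) / f ζ ^ ((k : ℝ)⁻¹)) (Ioi 1)

/-- Condition (1.5): `∫_1^∞ ζ^{p/m - 1} f(ζ)^{-1/m} dζ < ∞`. -/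
def Cond15 (m : ℕ) (p : ℝ) (f : ℝ → ℝ) : Prop :=
  IntegrableOn (fun ζ : ℝ => ζ ^ (p / (m : ℝ) - 1) / f ζ ^ ((m : ℝ)⁻¹)) (Ioi 1)

/-- `v ∈ L^1_loc(ℝⁿ)`. -/
def L1locInit (n : ℕ) (v : Spc n → ℝ) : Prop :=
  ∀ r : ℝ, 0 < r → IntegrableOn v (ball0 n r)

/-- `u` is a global weak solution of
`∂_t^k u - Σ_{|α| = m} ∂^α a_α(x,t,u) ≥ f(|u|)` in `ℝ^{n+1}_+`, with initial data
`∂_t^i u(·,0) = u0 i` for `0 ≤ i ≤ k-1`. -/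
def IsGlobalWeakSol (n k m : ℕ) (p : ℝ) (a : (Fin n → ℕ) → Spc n × ℝ → ℝ → ℝ)
    (f : ℝ → ℝ) (u0 : ℕ → Spc n → ℝ) (u : Spc n × ℝ → ℝ) : Prop :=
  (∀ r : ℝ, 0 < r → IntegrableOn u (cyl n r 1)) ∧
  (∀ r : ℝ, 0 < r → IntegrableOn (fun z => |u z| ^ p) (cyl n r 1)) ∧
  (∀ r : ℝ, 0 < r → IntegrableOn (fun z => f |u z|) (cyl n r 1)) ∧
  ∀ φ : Spc n × ℝ → ℝ, ContDiff ℝ (⊤ : ℕ∞) φ → HasCompactSupport φ →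
    (∀ z, 0 ≤ φ z) →
    (∫ z in halfSp n, (-1 : ℝ) ^ k * u z * (tDeriv n)^[k] φ z)
      - (∫ z in halfSp n, ∑ α ∈ mIdx n m, (-1 : ℝ) ^ m * a α z (u z) * mDeriv n α φ z)
    ≥ (∫ x : Spc n, ∑ i ∈ Finset.range k,
          (-1 : ℝ) ^ i * u0 (k - 1 - i) x * (tDeriv n)^[i] φ (x, 0))
      + ∫ z in halfSp n, f |u z| * φ z

/-- `u = 0` almost everywhere in `ℝ^{n+1}_+`. -/
def TrivialSol (n : ℕ) (u : Spc n × ℝ → ℝ) : Prop :=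
  ∀ᵐ z ∂(volume.restrict (halfSp n)), u z = 0

/-- The standing hypotheses of Section 3: the coefficients are Caratheodory functions
with the growth bound, `f` satisfies the monotonicity/convexity/positivity conditions
together with (1.4) and (1.5), and the initial data are locally integrable with
`u_{k-1} ≥ 0` a.e. -/
def Standing (n k m : ℕ) (A p : ℝ) (a : (Fin n → ℕ) → Spc n × ℝ → ℝ → ℝ)
    (f : ℝ → ℝ) (u0 : ℕ → Spc n → ℝ) : Prop :=
  GoodCoeffs n m A p a ∧ GoodF p f ∧
  (∀ i < k, L1locInit n (u0 i)) ∧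
  (∀ᵐ x ∂(volume : Measure (Spc n)), 0 ≤ u0 (k - 1) x) ∧
  Cond14 k f ∧ Cond15 m p f

/-- The function `F_κ(s) = (∫_s^∞ ζ^{1/k-1} f(ζ)^{-1/k} dζ)^{1/κ}
  + ∫_s^∞ ζ^{p/m-1} f(ζ)^{-1/m} dζ`. -/
def Fkappa (k m : ℕ) (p κ : ℝ) (f : ℝ → ℝ) (s : ℝ) : ℝ :=
  (∫ ζ in Ioi s, ζ ^ ((k : ℝ)⁻¹ - 1) / f ζ ^ ((k : ℝ)⁻¹)) ^ κ⁻¹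
    + ∫ ζ in Ioi s, ζ ^ (p / (m : ℝ) - 1) / f ζ ^ ((m : ℝ)⁻¹)

/-- The closed-in-space box `{|x_i| ≤ s L} × (0, s T]`. -/
def box (n : ℕ) (L T s : ℝ) : Set (Spc n × ℝ) :=
  {x : Spc n | ∀ i, |x i| ≤ s * L} ×ˢ Ioc 0 (s * T)

/-- A smooth even cutoff, equal to `1` on `[-a, a]` and to `0` off `(-b, b)`. -/
def cutoff (a b s : ℝ) : ℝ :=
  smoothTransition ((b - s) / (b - a)) + smoothTransition ((b + s) / (b - a)) - 1

lemma contDiff_cutoff (a b : ℝ) (N : ℕ∞) : ContDiff ℝ N (cutoff a b) := by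
  unfold cutoff
  have h1 : ContDiff ℝ N fun s : ℝ => smoothTransition ((b - s) / (b - a)) :=
    smoothTransition.contDiff.comp (by fun_prop)
  have h2 : ContDiff ℝ N fun s : ℝ => smoothTransition ((b + s) / (b - a)) :=
    smoothTransition.contDiff.comp (by fun_prop)
  exact (h1.add h2).sub contDiff_const

lemma cutoff_eq_one {a b s : ℝ} (hab : a < b) (hs : |s| ≤ a) : cutoff a b s = 1 := by
  have h := abs_le.1 hs
  have hd : 0 < b - a := sub_pos.2 hab
  unfold cutoff
  rw [smoothTransition.one_of_one_le, smoothTransition.one_of_one_le]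
  · ring
  · rw [le_div_iff₀ hd]; linarith
  · rw [le_div_iff₀ hd]; linarith

lemma cutoff_eq_zero {a b s : ℝ} (ha : 0 < a) (hab : a < b) (hs : b ≤ |s|) :
    cutoff a b s = 0 := by
  have hd : 0 < b - a := sub_pos.2 hab
  unfold cutoff
  rcases le_abs.1 hs with h | h
  · rw [smoothTransition.zero_of_nonpos, smoothTransition.one_of_one_le]
    · ring
    · rw [le_div_iff₀ hd]; linarith
    · exact div_nonpos_of_nonpos_of_nonneg (by linarith) hd.le
  · rw [smoothTransition.one_of_one_le, smoothTransition.zero_of_nonpos]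
    · ring
    · exact div_nonpos_of_nonpos_of_nonneg (by linarith) hd.le
    · rw [le_div_iff₀ hd]; linarith

lemma cutoff_nonneg {a b : ℝ} (ha : 0 < a) (hab : a < b) (s : ℝ) : 0 ≤ cutoff a b s := by
  have hd : 0 < b - a := sub_pos.2 hab
  unfold cutoff
  rcases le_total 0 s with h | h
  · rw [smoothTransition.one_of_one_le (x := (b + s) / (b - a))]
    · linarith [smoothTransition.nonneg ((b - s) / (b - a))]
    · rw [le_div_iff₀ hd]; linarith
  · rw [smoothTransition.one_of_one_le (x := (b - s) / (b - a))]
    · linarith [smoothTransition.nonneg ((b + s) / (b - a))]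
    · rw [le_div_iff₀ hd]; linarith

lemma iteratedDeriv_cutoff_eq_zero {a b s : ℝ} (ha : 0 < a) (hab : a < b) (hs : b < |s|)
    (j : ℕ) : iteratedDeriv j (cutoff a b) s = 0 := by
  have h : cutoff a b =ᶠ[nhds s] fun _ => (0 : ℝ) := by
    filter_upwards [(isOpen_lt continuous_const continuous_abs).mem_nhds hs] with y hy
    exact cutoff_eq_zero ha hab (le_of_lt hy)
  rw [h.iteratedDeriv_eq]
  simp

lemma iteratedDeriv_cutoff_zero {a b : ℝ} (ha : 0 < a) (hab : a < b) {j : ℕ} (hj : j ≠ 0) :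
    iteratedDeriv j (cutoff a b) 0 = 0 := by
  have h : cutoff a b =ᶠ[nhds 0] fun _ => (1 : ℝ) := by
    filter_upwards [(isOpen_lt continuous_abs continuous_const).mem_nhds
      (show |(0 : ℝ)| < a by simpa using ha)] with y hy
    exact cutoff_eq_one hab (le_of_lt hy)
  rw [h.iteratedDeriv_eq]
  simp [iteratedDeriv_const, hj]

lemma iteratedDeriv_smoothTransition_bounded (j : ℕ) :
    ∃ M : ℝ, ∀ s, |iteratedDeriv j smoothTransition s| ≤ M := by
  have hc : Continuous (iteratedDeriv j smoothTransition) :=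
    (smoothTransition.contDiff (n := (⊤ : ℕ∞))).continuous_iteratedDeriv j (by exact_mod_cast le_top)
  obtain ⟨M, hM⟩ := (isCompact_Icc (a := (0 : ℝ)) (b := 1)).exists_bound_of_continuousOn
    hc.continuousOn
  refine ⟨max M 1, fun s => ?_⟩
  by_cases hs : s ∈ Icc (0 : ℝ) 1
  · exact (hM s hs).trans (le_max_left _ _)
  refine le_trans ?_ (le_max_right _ _)
  rcases lt_or_ge s 0 with h | h
  · have : smoothTransition =ᶠ[nhds s] fun _ => (0 : ℝ) := by
      filter_upwards [Iio_mem_nhds h] with y hy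
      exact smoothTransition.zero_of_nonpos (le_of_lt hy)
    rw [this.iteratedDeriv_eq]
    simp
  · have h1 : 1 < s := by
      by_contra! h2
      exact hs ⟨h, h2⟩
    have : smoothTransition =ᶠ[nhds s] fun _ => (1 : ℝ) := by
      filter_upwards [Ioi_mem_nhds h1] with y hy
      exact smoothTransition.one_of_one_le (le_of_lt hy)
    rw [this.iteratedDeriv_eq, iteratedDeriv_const]
    split_ifs <;> simp

lemma iteratedDeriv_comp_affine {g : ℝ → ℝ} (hg : ContDiff ℝ (⊤ : ℕ∞) g) (c d : ℝ) (j : ℕ) :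
    iteratedDeriv j (fun s => g (c * s + d)) = fun s => c ^ j * iteratedDeriv j g (c * s + d) := by
  induction j with
  | zero => simp
  | succ j ih =>
    rw [iteratedDeriv_succ, ih]
    funext s
    have hd : DifferentiableAt ℝ (iteratedDeriv j g) (c * s + d) :=
      (hg.differentiable_iteratedDeriv j (by exact_mod_cast WithTop.coe_lt_top _)) _
    have h1 : HasDerivAt (fun s : ℝ => c * s + d) c s := by
      simpa using ((hasDerivAt_id s).const_mul c).add_const d
    have h2 := (hd.hasDerivAt.comp s h1).const_mul (c ^ j)
    rw [iteratedDeriv_succ, pow_succ]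
    refine h2.deriv.trans ?_
    ring

lemma exists_iteratedDeriv_cutoff_bound (N : ℕ) :
    ∃ K : ℝ, 1 ≤ K ∧ ∀ j ≤ N, ∀ a b s : ℝ, a < b →
      |iteratedDeriv j (cutoff a b) s| ≤ K * ((b - a)⁻¹) ^ j := by
  choose M hM using iteratedDeriv_smoothTransition_bounded
  have hM0 : ∀ j, 0 ≤ M j := fun j => (abs_nonneg _).trans (hM j 0)
  refine ⟨2 * (∑ j ∈ Finset.range (N + 1), M j) + 1, ?_, fun j hj a b s hab => ?_⟩
  · have := Finset.sum_nonneg fun j (_ : j ∈ Finset.range (N + 1)) => hM0 j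
    linarith
  have hMj : M j ≤ ∑ j ∈ Finset.range (N + 1), M j :=
    Finset.single_le_sum (fun j _ => hM0 j) (Finset.mem_range.2 (by omega))
  have hd : 0 < (b - a)⁻¹ := inv_pos.2 (sub_pos.2 hab)
  have hg := smoothTransition.contDiff (n := (⊤ : ℕ∞))
  set c := (b - a)⁻¹ with hc
  have e1 : cutoff a b = fun s => (fun s => smoothTransition ((-c) * s + b * c)) s
      + ((fun s => smoothTransition (c * s + b * c)) s + (fun _ => (-1 : ℝ)) s) := by
    funext s
    simp only [cutoff, div_eq_mul_inv, ← hc]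
    rw [show (b - s) * c = -c * s + b * c by ring, show (b + s) * c = c * s + b * c by ring]
    ring
  have hA : ContDiff ℝ (⊤ : ℕ∞) fun s => smoothTransition ((-c) * s + b * c) :=
    hg.comp (by fun_prop)
  have hB : ContDiff ℝ (⊤ : ℕ∞) fun s => smoothTransition (c * s + b * c) :=
    hg.comp (by fun_prop)
  have hle : ((j : ℕ∞) : WithTop ℕ∞) ≤ ((⊤ : ℕ∞) : WithTop ℕ∞) := by exact_mod_cast le_top
  have e2 : iteratedDeriv j (cutoff a b) s =
      (-c) ^ j * iteratedDeriv j smoothTransition (-c * s + b * c)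
      + (c ^ j * iteratedDeriv j smoothTransition (c * s + b * c)
        + iteratedDeriv j (fun _ => (-1 : ℝ)) s) := by
    rw [e1]
    rw [iteratedDeriv_fun_add (hA.of_le hle).contDiffAt
      ((hB.add contDiff_const).of_le hle).contDiffAt,
      iteratedDeriv_fun_add (hB.of_le hle).contDiffAt contDiffAt_const,
      iteratedDeriv_comp_affine hg, iteratedDeriv_comp_affine hg]
  have h3 : |iteratedDeriv j (fun _ => (-1 : ℝ)) s| ≤ c ^ j := by
    rw [iteratedDeriv_const]
    split_ifs with h
    · simp [h]
    · simpa using (pow_pos hd j).le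
  have h1 : |(-c) ^ j * iteratedDeriv j smoothTransition (-c * s + b * c)| ≤ c ^ j * M j := by
    rw [abs_mul, abs_pow, abs_neg, abs_of_pos hd]
    exact mul_le_mul_of_nonneg_left (hM _ _) (pow_pos hd j).le
  have h2 : |c ^ j * iteratedDeriv j smoothTransition (c * s + b * c)| ≤ c ^ j * M j := by
    rw [abs_mul, abs_pow, abs_of_pos hd]
    exact mul_le_mul_of_nonneg_left (hM _ _) (pow_pos hd j).le
  rw [e2]
  refine (abs_add_le _ _).trans ((add_le_add le_rfl (abs_add_le _ _)).trans ?_)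
  have h4 := mul_le_mul_of_nonneg_left hMj (pow_pos hd j).le
  linarith

/-- The function `(x, t) ↦ θ(t) ∏ h_i(x_i)`. -/
def tensor (n : ℕ) (h : Fin n → ℝ → ℝ) (θ : ℝ → ℝ) : Spc n × ℝ → ℝ :=
  fun z => (∏ i, h i (z.1 i)) * θ z.2

lemma contDiff_tensor {n : ℕ} {h : Fin n → ℝ → ℝ} {θ : ℝ → ℝ} {N : ℕ∞}
    (hh : ∀ i, ContDiff ℝ N (h i)) (hθ : ContDiff ℝ N θ) : ContDiff ℝ N (tensor n h θ) := by
  unfold tensor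
  refine (contDiff_prod fun i _ => (hh i).comp ?_).mul (hθ.comp contDiff_snd)
  exact (EuclideanSpace.proj (𝕜 := ℝ) i).contDiff.comp contDiff_fst

lemma spDeriv_tensor (n : ℕ) (h : Fin n → ℝ → ℝ) (θ : ℝ → ℝ) (j : Fin n) :
    spDeriv n j (tensor n h θ) = tensor n (Function.update h j (deriv (h j))) θ := by
  funext z
  have e : (fun s : ℝ => tensor n h θ (z.1 + s • EuclideanSpace.single j (1 : ℝ), z.2)) =
      fun s => ((∏ i ∈ Finset.univ.erase j, h i (z.1 i)) * θ z.2) * h j (z.1 j + s) := by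
    funext s
    simp only [tensor]
    rw [← Finset.mul_prod_erase _ _ (Finset.mem_univ j)]
    rw [Finset.prod_congr rfl (g := fun i => h i (z.1 i))]
    · simp; ring
    · intro i hi
      simp [Finset.ne_of_mem_erase hi]
  unfold spDeriv
  rw [e, deriv_const_mul_field, deriv_comp_const_add]
  simp only [tensor]
  rw [← Finset.mul_prod_erase _ _ (Finset.mem_univ j)]
  rw [Finset.prod_congr rfl (s₁ := Finset.univ.erase j)
    (g := fun i => h i (z.1 i)) (f := fun i => Function.update h j (deriv (h j)) i (z.1 i))]
  · simp; ring
  · intro i hi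
    simp [Finset.ne_of_mem_erase hi]

lemma spDeriv_iterate_tensor (n : ℕ) (h : Fin n → ℝ → ℝ) (θ : ℝ → ℝ) (j : Fin n) (l : ℕ) :
    (spDeriv n j)^[l] (tensor n h θ) =
      tensor n (Function.update h j (iteratedDeriv l (h j))) θ := by
  induction l with
  | zero => simp
  | succ l ih =>
    rw [Function.iterate_succ_apply', ih, spDeriv_tensor]
    simp [iteratedDeriv_succ]

lemma tDeriv_iterate_tensor (n : ℕ) (h : Fin n → ℝ → ℝ) (θ : ℝ → ℝ) (l : ℕ) :
    (tDeriv n)^[l] (tensor n h θ) = tensor n h (iteratedDeriv l θ) := by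
  induction l with
  | zero => simp
  | succ l ih =>
    rw [Function.iterate_succ_apply', ih]
    funext z
    simp only [tDeriv, tensor]
    rw [deriv_const_mul_field, iteratedDeriv_succ]

lemma mDeriv_tensor (n : ℕ) (α : Fin n → ℕ) (h : Fin n → ℝ → ℝ) (θ : ℝ → ℝ) :
    mDeriv n α (tensor n h θ) = tensor n (fun i => iteratedDeriv (α i) (h i)) θ := by
  have key : ∀ l : List (Fin n), l.Nodup →
      l.foldr (fun i ψ => (spDeriv n i)^[α i] ψ) (tensor n h θ) =
        tensor n (fun i => if i ∈ l then iteratedDeriv (α i) (h i) else h i) θ := by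
    intro l hl
    induction l with
    | nil => simp
    | cons j l ih =>
      obtain ⟨hj, hl'⟩ := List.nodup_cons.1 hl
      rw [List.foldr_cons, ih hl', spDeriv_iterate_tensor]
      congr 1
      funext i
      by_cases hij : i = j
      · subst hij
        simp [hj]
      · simp [hij]
  rw [mDeriv, key _ (List.nodup_finRange n)]
  simp

lemma le_of_doubling {J Ψ : ℝ → ℝ} {a b : ℝ} (hab : a ≤ b) (hJ : MonotoneOn J (Icc a b))
    (hJa : 0 < J a) (hΨ : AntitoneOn Ψ (Ioi 0)) (hΨ0 : ∀ z, 0 < z → 0 ≤ Ψ z)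
    (hstep : ∀ r s, a ≤ r → r < s → s ≤ b → J s ≤ 2 * J r → s - r ≤ Ψ (J r / 2) - Ψ (J r)) :
    b - a ≤ Ψ (J a / 2) := by
  have key : ∀ N : ℕ, ∀ r ∈ Icc a b, J b ≤ 2 ^ (N + 1) * J r → b - r ≤ Ψ (J r / 2) := by
    intro N
    have base : ∀ r ∈ Icc a b, J b ≤ 2 * J r → b - r ≤ Ψ (J r / 2) := by
      intro r hr h
      have hJr : 0 < J r := hJa.trans_le (hJ ⟨le_rfl, hab⟩ hr hr.1)
      rcases hr.2.eq_or_lt with rfl | hlt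
      · simpa using hΨ0 _ (half_pos hJr)
      · have := hstep r b hr.1 hlt le_rfl h
        linarith [hΨ0 (J r) hJr]
    induction N with
    | zero => exact fun r hr h => base r hr (by simpa using h)
    | succ N ih =>
      intro r hr h
      have hJr : 0 < J r := hJa.trans_le (hJ ⟨le_rfl, hab⟩ hr hr.1)
      by_cases h2 : J b ≤ 2 * J r
      · exact base r hr h2
      refine le_of_forall_pos_le_add fun ε hε => ?_
      set S := {s | s ∈ Icc r b ∧ J s ≤ 2 * J r}
      have hrS : r ∈ S := ⟨⟨le_rfl, hr.2⟩, by linarith⟩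
      have hbdd : BddAbove S := ⟨b, fun s hs => hs.1.2⟩
      obtain ⟨s, hsS, hs⟩ := exists_lt_of_lt_csSup ⟨r, hrS⟩
        (show sSup S - ε / 2 < sSup S by linarith)
      have hrc : r ≤ sSup S := le_csSup hbdd hrS
      obtain ⟨s', hs', hle, hJs'⟩ :
          ∃ s' ∈ Icc a b, s' ≤ sSup S + ε / 2 ∧ 2 * J r < J s' := by
        rcases le_total b (sSup S + ε / 2) with hb | hb
        · exact ⟨b, ⟨hab, le_rfl⟩, hb, not_le.1 h2⟩
        · refine ⟨sSup S + ε / 2, ⟨by linarith [hr.1], hb⟩, le_rfl, ?_⟩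
          by_contra! hcon
          have : sSup S + ε / 2 ≤ sSup S := le_csSup hbdd ⟨⟨by linarith, hb⟩, hcon⟩
          linarith
      have h3 : b - s' ≤ Ψ (J s' / 2) := by
        refine ih s' hs' (h.trans ?_)
        have : (0 : ℝ) < 2 ^ (N + 1) := by positivity
        rw [pow_succ _ (N + 1), mul_assoc]
        exact mul_le_mul_of_nonneg_left hJs'.le this.le
      have h4 : Ψ (J s' / 2) ≤ Ψ (J r) :=
        hΨ (mem_Ioi.2 hJr) (mem_Ioi.2 (by linarith)) (by linarith)
      have h5 : s - r ≤ Ψ (J r / 2) - Ψ (J r) := by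
        rcases hsS.1.1.eq_or_lt with rfl | hlt
        · have := hΨ (mem_Ioi.2 (half_pos hJr)) (mem_Ioi.2 hJr) (by linarith)
          linarith
        · exact hstep r s hr.1 hlt hsS.1.2 hsS.2
      linarith
  obtain ⟨N, hN⟩ := pow_unbounded_of_one_lt (J b / J a) (one_lt_two (α := ℝ))
  refine key N a ⟨le_rfl, hab⟩ ?_
  have h1 : J b < 2 ^ N * J a := (div_lt_iff₀ hJa).1 hN
  have h2 : (0 : ℝ) < 2 ^ N * J a := by positivity
  rw [pow_succ]
  nlinarith

lemma measurableSet_halfSp (n : ℕ) : MeasurableSet (halfSp n) :=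
  (isOpen_lt continuous_const continuous_snd).measurableSet

lemma measurableSet_spatialBox (n : ℕ) (c : ℝ) : MeasurableSet {x : Spc n | ∀ i, |x i| ≤ c} := by
  have : IsClosed {x : Spc n | ∀ i, |x i| ≤ c} := by
    simp only [ofPred_forall]
    exact isClosed_iInter fun i => isClosed_le (by fun_prop) continuous_const
  exact this.measurableSet

lemma measurableSet_box (n : ℕ) (L T s : ℝ) : MeasurableSet (box n L T s) :=
  (measurableSet_spatialBox n _).prod measurableSet_Ioc

lemma box_subset_halfSp (n : ℕ) (L T s : ℝ) : box n L T s ⊆ halfSp n := fun _ hz => hz.2.1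

lemma box_mono {n : ℕ} {L T r s : ℝ} (hL : 0 ≤ L) (hT : 0 ≤ T) (hrs : r ≤ s) :
    box n L T r ⊆ box n L T s := fun _ hz =>
  ⟨fun i => (hz.1 i).trans (mul_le_mul_of_nonneg_right hrs hL),
    hz.2.1, hz.2.2.trans (mul_le_mul_of_nonneg_right hrs hT)⟩

lemma isCompact_spatialBox (n : ℕ) (c : ℝ) : IsCompact {x : Spc n | ∀ i, |x i| ≤ c} := by
  have h := (isCompact_univ_pi fun _ : Fin n => isCompact_Icc (a := -c) (b := c)).image
    (PiLp.continuous_toLp 2 fun _ : Fin n => ℝ)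
  convert h using 1
  ext x
  simp only [mem_ofPred_eq, mem_image, mem_univ_pi, mem_Icc]
  constructor
  · intro hx
    exact ⟨WithLp.ofLp x, fun i => abs_le.1 (hx i), rfl⟩
  · rintro ⟨y, hy, rfl⟩ i
    exact abs_le.2 (hy i)

lemma exists_box_subset_cyl (n : ℕ) (L T s : ℝ) : ∃ r : ℝ, 0 < r ∧ box n L T s ⊆ cyl n r 1 := by
  obtain ⟨ρ, hρ⟩ := (isCompact_spatialBox n (s * L)).isBounded.subset_ball (0 : Spc n)
  refine ⟨max (max ρ (s * T + 1)) 1, by positivity, fun z hz => ⟨?_, hz.2.1, ?_⟩⟩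
  · exact Metric.ball_subset_ball ((le_max_left _ _).trans (le_max_left _ _)) (hρ hz.1)
  · rw [rpow_one]
    have h1 : s * T + 1 ≤ max (max ρ (s * T + 1)) 1 := (le_max_right _ _).trans (le_max_left _ _)
    linarith [hz.2.2]

lemma cyl_subset_box {n : ℕ} {R κ : ℝ} : cyl n R κ ⊆ box n R (R ^ κ) 1 := by
  intro z hz
  refine ⟨fun i => ?_, hz.2.1, by simpa using hz.2.2.le⟩
  have h1 : ‖z.1‖ < R := by simpa using mem_ball_zero_iff.1 hz.1
  have h2 : ‖z.1 i‖ ≤ ‖z.1‖ := PiLp.norm_apply_le z.1 i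
  rw [one_mul]
  exact h2.trans h1.le

lemma volume_real_box {n : ℕ} {L T s : ℝ} (hL : 0 ≤ L) (hT : 0 ≤ T) (hs : 0 ≤ s) :
    volume.real (box n L T s) = (2 * (s * L)) ^ n * (s * T) := by
  have hsL : 0 ≤ s * L := mul_nonneg hs hL
  have h1 : volume {x : Spc n | ∀ i, |x i| ≤ s * L} = ENNReal.ofReal ((2 * (s * L)) ^ n) := by
    have e : {x : Spc n | ∀ i, |x i| ≤ s * L} =
        WithLp.ofLp ⁻¹' (Set.pi univ fun _ : Fin n => Icc (-(s * L)) (s * L)) := by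
      ext x
      simp only [mem_preimage, mem_univ_pi, mem_Icc, abs_le, mem_ofPred_eq]
    rw [e, (PiLp.volume_preserving_ofLp (Fin n)).measure_preimage
      (MeasurableSet.univ_pi fun _ => measurableSet_Icc).nullMeasurableSet, volume_pi_pi]
    simp only [Real.volume_Icc, Finset.prod_const, Finset.card_univ, Fintype.card_fin]
    rw [← ENNReal.ofReal_pow (by linarith)]
    congr 2
    ring
  rw [measureReal_def, box, Measure.volume_eq_prod, Measure.prod_prod, h1, Real.volume_Ioc,
    ENNReal.toReal_mul, ENNReal.toReal_ofReal (by positivity), sub_zero,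
    ENNReal.toReal_ofReal (mul_nonneg hs hT)]

lemma GoodF.nonneg_zero {p : ℝ} {f : ℝ → ℝ} (hf : GoodF p f) : 0 ≤ f 0 := by
  obtain ⟨-, hc, -, -, hpos⟩ := hf
  have h : ∀ᶠ x in nhdsWithin (0 : ℝ) (Ioi 0), 0 ≤ (1 - x) * f 0 + x * f 1 := by
    filter_upwards [Ioo_mem_nhdsGT (zero_lt_one (α := ℝ))] with x hx
    have h2 := hc.2 (mem_Ici.2 le_rfl) (mem_Ici.2 zero_le_one) (sub_nonneg.2 hx.2.le) hx.1.le
      (by ring)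
    simp only [smul_eq_mul, mul_zero, mul_one, zero_add] at h2
    exact (hpos x hx.1).le.trans h2
  have ht : Tendsto (fun x : ℝ => (1 - x) * f 0 + x * f 1) (nhdsWithin 0 (Ioi 0)) (nhds (f 0)) := by
    have : Continuous fun x : ℝ => (1 - x) * f 0 + x * f 1 := by fun_prop
    simpa using (this.tendsto 0).mono_left nhdsWithin_le_nhds
  exact ge_of_tendsto ht h

lemma GoodF.nonneg {p : ℝ} {f : ℝ → ℝ} (hf : GoodF p f) {x : ℝ} (hx : 0 ≤ x) : 0 ≤ f x :=
  hf.nonneg_zero.trans (hf.1 (mem_Ici.2 le_rfl) hx hx)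

lemma GoodF.continuousOn {p : ℝ} {f : ℝ → ℝ} (hf : GoodF p f) : ContinuousOn f (Ici 0) := by
  intro x hx
  rcases (mem_Ici.1 hx).eq_or_lt with rfl | hlt
  · obtain ⟨hm, hc, -, -, -⟩ := hf
    have ht : Tendsto (fun x : ℝ => (1 - x) * f 0 + x * f 1) (nhdsWithin 0 (Ici 0))
        (nhds (f 0)) := by
      have : Continuous fun x : ℝ => (1 - x) * f 0 + x * f 1 := by fun_prop
      simpa using (this.tendsto 0).mono_left nhdsWithin_le_nhds
    refine tendsto_of_tendsto_of_tendsto_of_le_of_le' tendsto_const_nhds ht ?_ ?_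
    · filter_upwards [self_mem_nhdsWithin] with y hy using hm (mem_Ici.2 le_rfl) hy hy
    · filter_upwards [Icc_mem_nhdsGE (zero_lt_one (α := ℝ))] with y hy
      have h2 := hc.2 (mem_Ici.2 le_rfl) (mem_Ici.2 zero_le_one) (sub_nonneg.2 hy.2) hy.1
        (by ring)
      simpa using h2
  · have h1 : ContinuousOn f (Ioi 0) :=
      (hf.2.1.subset Ioi_subset_Ici_self (convex_Ioi 0)).continuousOn isOpen_Ioi
    exact (h1.continuousAt (Ioi_mem_nhds hlt)).continuousWithinAt

lemma tensor_iteratedDeriv_cutoff_abs_le {n N : ℕ} {K : ℝ} (hK1 : 1 ≤ K)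
    (hK : ∀ j ≤ N, ∀ a b s : ℝ, a < b → |iteratedDeriv j (cutoff a b) s| ≤ K * ((b - a)⁻¹) ^ j)
    {L T r s : ℝ} (hL : 0 < L) (hT : 0 < T) (hrs : r < s)
    (β : Fin n → ℕ) (hβ : ∀ i, β i ≤ N) {j : ℕ} (hj : j ≤ N) (z : Spc n × ℝ) :
    |tensor n (fun i => iteratedDeriv (β i) (cutoff (r * L) (s * L)))
      (iteratedDeriv j (cutoff (r * T) (s * T))) z| ≤
      K ^ (n + 1) * ((((s - r) * L)⁻¹) ^ (∑ i, β i) * (((s - r) * T)⁻¹) ^ j) := by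
  have h1 : ∀ i, |iteratedDeriv (β i) (cutoff (r * L) (s * L)) (z.1 i)| ≤
      K * (((s - r) * L)⁻¹) ^ β i := fun i => by
    rw [sub_mul]
    exact hK _ (hβ i) _ _ _ (mul_lt_mul_of_pos_right hrs hL)
  have h2 : |iteratedDeriv j (cutoff (r * T) (s * T)) z.2| ≤ K * (((s - r) * T)⁻¹) ^ j := by
    rw [sub_mul]
    exact hK _ hj _ _ _ (mul_lt_mul_of_pos_right hrs hT)
  rw [tensor, abs_mul, Finset.abs_prod]
  have hd : 0 < s - r := sub_pos.2 hrs
  calc _ ≤ (∏ i, (K * (((s - r) * L)⁻¹) ^ β i)) * (K * (((s - r) * T)⁻¹) ^ j) := by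
        refine mul_le_mul (Finset.prod_le_prod (fun _ _ => abs_nonneg _) fun i _ => h1 i) h2
          (abs_nonneg _) (Finset.prod_nonneg fun i _ => by positivity)
    _ = _ := by
        rw [Finset.prod_mul_distrib, Finset.prod_pow_eq_pow_sum]
        simp only [Finset.prod_const, Finset.card_univ, Fintype.card_fin]
        ring

lemma tensor_iteratedDeriv_cutoff_eq_zero {n : ℕ} {L T r s : ℝ} (hL : 0 < L) (hT : 0 < T)
    (hr : 0 < r) (hrs : r < s) (β : Fin n → ℕ) (j : ℕ) {z : Spc n × ℝ} (hz : z ∈ halfSp n)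
    (hzb : z ∉ box n L T s) :
    tensor n (fun i => iteratedDeriv (β i) (cutoff (r * L) (s * L)))
      (iteratedDeriv j (cutoff (r * T) (s * T))) z = 0 := by
  have hcase : (∃ i, s * L < |z.1 i|) ∨ s * T < z.2 := by
    by_contra! hcon
    exact hzb ⟨hcon.1, hz, hcon.2⟩
  rcases hcase with ⟨i, hi⟩ | ht
  · rw [tensor, Finset.prod_eq_zero (Finset.mem_univ i), zero_mul]
    exact iteratedDeriv_cutoff_eq_zero (mul_pos hr hL) (mul_lt_mul_of_pos_right hrs hL) hi _
  · rw [tensor, iteratedDeriv_cutoff_eq_zero (mul_pos hr hT) (mul_lt_mul_of_pos_right hrs hT)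
      (ht.trans_le (le_abs_self _)), mul_zero]

lemma integral_le_of_abs_le_indicator {n : ℕ} {L T s c : ℝ} {F g : Spc n × ℝ → ℝ}
    (hg : IntegrableOn g (box n L T s))
    (h : ∀ᵐ z ∂(volume.restrict (halfSp n)),
      |F z| ≤ (box n L T s).indicator (fun z => c * g z) z) :
    |∫ z in halfSp n, F z| ≤ c * ∫ z in box n L T s, g z := by
  have hi : Integrable ((box n L T s).indicator fun z => c * g z)
      (volume.restrict (halfSp n)) :=
    ((integrable_indicator_iff (measurableSet_box n L T s)).2 (hg.const_mul c)).integrableOn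
  refine (MeasureTheory.norm_integral_le_of_norm_le (f := F) hi h).trans (le_of_eq ?_)
  rw [setIntegral_indicator (measurableSet_box n L T s),
    inter_eq_self_of_subset_right (box_subset_halfSp n L T s), integral_const_mul]

lemma energy_estimate {n k m : ℕ} (hk : 1 ≤ k) {A p K : ℝ} (hA : 0 < A) (hK1 : 1 ≤ K)
    (hK : ∀ j ≤ max k m, ∀ a b s : ℝ, a < b →
      |iteratedDeriv j (cutoff a b) s| ≤ K * ((b - a)⁻¹) ^ j)
    {a : (Fin n → ℕ) → Spc n × ℝ → ℝ → ℝ} {f : ℝ → ℝ} {u0 : ℕ → Spc n → ℝ}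
    {u : Spc n × ℝ → ℝ} (hS : Standing n k m A p a f u0) (hu : IsGlobalWeakSol n k m p a f u0 u)
    {L T r s : ℝ} (hL : 0 < L) (hT : 0 < T) (hr : 0 < r) (hrs : r < s) :
    ∫ z in box n L T r, f |u z| ≤
      K ^ (n + 1) * (((s - r) * T)⁻¹) ^ k * (∫ z in box n L T s, |u z|) +
      (mIdx n m).card * (A * (K ^ (n + 1) * (((s - r) * L)⁻¹) ^ m)) *
        ∫ z in box n L T s, |u z| ^ p := by
  obtain ⟨ha, hf, -, hpos, -, -⟩ := hS
  obtain ⟨hu1, hup, huf, hineq⟩ := hu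
  have hd : 0 < s - r := sub_pos.2 hrs
  have hrL := mul_pos hr hL
  have hrT := mul_pos hr hT
  have hrsL : r * L < s * L := mul_lt_mul_of_pos_right hrs hL
  have hrsT : r * T < s * T := mul_lt_mul_of_pos_right hrs hT
  obtain ⟨ρ, hρ, hbox⟩ := exists_box_subset_cyl n L T s
  set X := cutoff (r * L) (s * L) with hX
  set Y := cutoff (r * T) (s * T) with hY
  set φ := tensor n (fun _ => X) Y with hφ
  have hφC : ContDiff ℝ (⊤ : ℕ∞) φ :=
    contDiff_tensor (fun _ => contDiff_cutoff _ _ _) (contDiff_cutoff _ _ _)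
  have hφ0 : ∀ z, 0 ≤ φ z := fun z =>
    mul_nonneg (Finset.prod_nonneg fun i _ => cutoff_nonneg hrL hrsL _)
      (cutoff_nonneg hrT hrsT _)
  have hφs : HasCompactSupport φ := by
    refine HasCompactSupport.intro ((isCompact_spatialBox n (s * L)).prod
      (isCompact_Icc (a := -(s * T)) (b := s * T))) fun z hz => ?_
    have hcase : (∃ i, s * L < |z.1 i|) ∨ s * T < |z.2| := by
      by_contra! hcon
      exact hz ⟨hcon.1, abs_le.1 hcon.2⟩
    rcases hcase with ⟨i, hi⟩ | ht
    · rw [hφ, tensor, Finset.prod_eq_zero (Finset.mem_univ i), zero_mul]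
      exact cutoff_eq_zero hrL hrsL hi.le
    · rw [hφ, tensor, hY, cutoff_eq_zero hrT hrsT ht.le, mul_zero]
  have hsol := hineq φ hφC hφs hφ0
  have hI0 : 0 ≤ ∫ x : Spc n, ∑ i ∈ Finset.range k,
      (-1 : ℝ) ^ i * u0 (k - 1 - i) x * (tDeriv n)^[i] φ (x, 0) := by
    refine integral_nonneg_of_ae ?_
    filter_upwards [hpos] with x hx
    rw [Finset.sum_eq_single 0]
    · simpa using mul_nonneg hx (hφ0 (x, 0))
    · intro i _ hi
      rw [hφ, tDeriv_iterate_tensor]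
      simp only [tensor]
      rw [iteratedDeriv_cutoff_zero hrT hrsT hi]
      ring
    · intro h0
      exact absurd (Finset.mem_range.2 (by omega)) h0
  have hI1 : |∫ z in halfSp n, (-1 : ℝ) ^ k * u z * (tDeriv n)^[k] φ z| ≤
      K ^ (n + 1) * (((s - r) * T)⁻¹) ^ k * ∫ z in box n L T s, |u z| := by
    refine integral_le_of_abs_le_indicator (hu1 ρ hρ |>.mono_set hbox |>.abs)
      (ae_restrict_of_forall_mem (measurableSet_halfSp n) fun z hz => ?_)
    have e : (tDeriv n)^[k] φ z =
        tensor n (fun i => iteratedDeriv ((0 : Fin n → ℕ) i) X) (iteratedDeriv k Y) z := by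
      rw [hφ, tDeriv_iterate_tensor]
      simp
    rw [e]
    by_cases hzb : z ∈ box n L T s
    · rw [indicator_of_mem hzb, abs_mul, abs_mul, abs_pow, abs_neg, abs_one, one_pow, one_mul,
        mul_comm]
      have := tensor_iteratedDeriv_cutoff_abs_le hK1 hK hL hT hrs 0 (by simp)
        (le_max_left k m) z
      simp only [Pi.zero_apply, Finset.sum_const_zero, pow_zero, one_mul] at this
      exact mul_le_mul_of_nonneg_right this (abs_nonneg _)
    · rw [indicator_of_notMem hzb,
        tensor_iteratedDeriv_cutoff_eq_zero hL hT hr hrs 0 k hz hzb, mul_zero, abs_zero]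
  have hI2 : |∫ z in halfSp n,
        ∑ α ∈ mIdx n m, (-1 : ℝ) ^ m * a α z (u z) * mDeriv n α φ z| ≤
      (mIdx n m).card * (A * (K ^ (n + 1) * (((s - r) * L)⁻¹) ^ m)) *
        ∫ z in box n L T s, |u z| ^ p := by
    refine integral_le_of_abs_le_indicator ((hup ρ hρ).mono_set hbox) ?_
    have hall : ∀ᵐ z ∂(volume.restrict (halfSp n)), ∀ α ∈ mIdx n m, ∀ ζ : ℝ,
        |a α z ζ| ≤ A * |ζ| ^ p := by
      exact (Filter.eventually_all_finset _).2 fun α hα => (ha α hα).2.2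
    filter_upwards [hall, ae_restrict_mem (measurableSet_halfSp n)] with z haz hz
    have e : ∀ α, mDeriv n α φ z =
        tensor n (fun i => iteratedDeriv (α i) X) (iteratedDeriv 0 Y) z := fun α => by
      rw [hφ, mDeriv_tensor, iteratedDeriv_zero]
    by_cases hzb : z ∈ box n L T s
    · rw [indicator_of_mem hzb]
      refine (Finset.abs_sum_le_sum_abs _ _).trans ?_
      rw [mul_assoc, ← nsmul_eq_mul]
      refine Finset.sum_le_card_nsmul _ _ _ fun α hα => ?_
      obtain ⟨hα1, hα2⟩ := Finset.mem_filter.1 hα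
      have hαm : ∀ i, α i ≤ max k m := fun i =>
        (Nat.lt_succ_iff.1 (Finset.mem_range.1 (Fintype.mem_piFinset.1 hα1 i))).trans
          (le_max_right k m)
      have hb := tensor_iteratedDeriv_cutoff_abs_le hK1 hK hL hT hrs α hαm
        (Nat.zero_le _ : 0 ≤ max k m) z
      rw [hα2, pow_zero, mul_one] at hb
      rw [e, abs_mul, abs_mul, abs_pow, abs_neg, abs_one, one_pow, one_mul]
      calc _ ≤ (A * |u z| ^ p) * (K ^ (n + 1) * (((s - r) * L)⁻¹) ^ m) :=
            mul_le_mul (haz α hα (u z)) hb (abs_nonneg _) (by positivity)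
        _ = _ := by ring
    · rw [indicator_of_notMem hzb, Finset.sum_eq_zero, abs_zero]
      intro α _
      rw [e, tensor_iteratedDeriv_cutoff_eq_zero hL hT hr hrs α 0 hz hzb, mul_zero]
  have hfint : IntegrableOn (fun z => f |u z|) (box n L T s) := (huf ρ hρ).mono_set hbox
  have hφ1 : ∀ z, φ z ≤ K ^ (n + 1) := fun z => by
    have := tensor_iteratedDeriv_cutoff_abs_le hK1 hK hL hT hrs (0 : Fin n → ℕ) (by simp)
      (Nat.zero_le _ : 0 ≤ max k m) z
    simp only [Pi.zero_apply, Finset.sum_const_zero, pow_zero, mul_one, iteratedDeriv_zero]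
      at this
    exact (le_abs_self _).trans this
  have hI3 : ∫ z in box n L T r, f |u z| ≤ ∫ z in halfSp n, f |u z| * φ z := by
    have hint : IntegrableOn (fun z => f |u z| * φ z) (box n L T s) :=
      Integrable.mul_bdd (c := K ^ (n + 1)) hfint hφC.continuous.aestronglyMeasurable
        (Eventually.of_forall fun z => by
          rw [Real.norm_of_nonneg (hφ0 z)]
          exact hφ1 z)
    have e1 : ∫ z in halfSp n, f |u z| * φ z = ∫ z in box n L T s, f |u z| * φ z := by
      refine (setIntegral_eq_of_subset_of_forall_sdiff_eq_zero (measurableSet_halfSp n)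
        (box_subset_halfSp n L T s) fun z hz => ?_)
      have := tensor_iteratedDeriv_cutoff_eq_zero hL hT hr hrs (0 : Fin n → ℕ) 0 hz.1 hz.2
      simp only [Pi.zero_apply, iteratedDeriv_zero] at this
      rw [hφ, this, mul_zero]
    have e2 : ∫ z in box n L T r, f |u z| = ∫ z in box n L T r, f |u z| * φ z := by
      refine setIntegral_congr_fun (measurableSet_box n L T r) fun z hz => ?_
      have h1 : φ z = 1 := by
        rw [hφ, tensor, Finset.prod_eq_one fun i _ => cutoff_eq_one hrsL (hz.1 i), one_mul]
        exact cutoff_eq_one hrsT (by rw [abs_of_pos hz.2.1]; exact hz.2.2)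
      simp only [h1, mul_one]
    rw [e1, e2]
    exact setIntegral_mono_set hint
      (Eventually.of_forall fun z => mul_nonneg (hf.nonneg (abs_nonneg _)) (hφ0 z))
      (box_mono hL.le hT.le hrs.le).eventuallyLE
  have h1 := (abs_le.1 hI1).2
  have h2 := (abs_le.1 hI2).1
  linarith

lemma average_estimate {n k m : ℕ} (hk : 1 ≤ k) {A p K : ℝ} (hA : 0 < A) (hp0 : 0 < p)
    (hp1 : p ≤ 1) (hK1 : 1 ≤ K)
    (hK : ∀ j ≤ max k m, ∀ a b s : ℝ, a < b →
      |iteratedDeriv j (cutoff a b) s| ≤ K * ((b - a)⁻¹) ^ j)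
    {a : (Fin n → ℕ) → Spc n × ℝ → ℝ → ℝ} {f : ℝ → ℝ} {u0 : ℕ → Spc n → ℝ}
    {u : Spc n × ℝ → ℝ} (hS : Standing n k m A p a f u0) (hu : IsGlobalWeakSol n k m p a f u0 u)
    {L T W r s : ℝ} (hL : 0 < L) (hT : 0 < T) (hW : W = (4 * L) ^ n * (2 * T))
    (hr : 1 ≤ r) (hrs : r < s) (hs : s ≤ 2) :
    f (W⁻¹ * ∫ z in box n L T r, |u z|) ≤
      2 ^ (n + 1) * K ^ (n + 1) * (1 + (mIdx n m).card * A) *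
        ((((s - r) * T)⁻¹) ^ k * (W⁻¹ * ∫ z in box n L T s, |u z|) +
          (((s - r) * L)⁻¹) ^ m * (W⁻¹ * ∫ z in box n L T s, |u z|) ^ p) := by
  have hE := energy_estimate hk hA hK1 hK hS hu hL hT (by linarith) hrs
  have hf := hS.2.1
  obtain ⟨hu1, hup, huf, -⟩ := hu
  obtain ⟨ρ, hρ, hbox⟩ := exists_box_subset_cyl n L T s
  have hsub : box n L T r ⊆ box n L T s := box_mono hL.le hT.le hrs.le
  have hW0 : 0 < W := by rw [hW]; positivity
  have hd : 0 < s - r := sub_pos.2 hrs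
  have hr0 : 0 < r := by linarith
  have hs0 : 0 < s := by linarith
  have hVr := volume_real_box (n := n) hL.le hT.le hr0.le
  have hVs := volume_real_box (n := n) hL.le hT.le hs0.le
  have hVr0 : 0 < volume.real (box n L T r) := by rw [hVr]; positivity
  have hVs0 : 0 < volume.real (box n L T s) := by rw [hVs]; positivity
  have hne : ∀ {E : Set (Spc n × ℝ)}, 0 < volume.real E → volume E ≠ 0 ∧ volume E ≠ ⊤ := by
    intro E hE
    rw [measureReal_def, ENNReal.toReal_pos_iff] at hE
    exact ⟨hE.1.ne', hE.2.ne⟩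
  have hVsW : volume.real (box n L T s) ≤ W := by
    rw [hVs, hW]
    exact mul_le_mul (pow_le_pow_left₀ (by positivity) (by nlinarith) n)
      (mul_le_mul_of_nonneg_right hs hT.le) (by positivity) (by positivity)
  have hVrW : volume.real (box n L T r) ≤ W :=
    (measureReal_mono hsub (hne hVs0).2).trans hVsW
  have hWVr : W ≤ 2 ^ (n + 1) * volume.real (box n L T r) := by
    rw [hVr, hW, pow_succ, show (2 : ℝ) ^ n * 2 * ((2 * (r * L)) ^ n * (r * T)) =
      (2 * (2 * (r * L))) ^ n * (2 * (r * T)) by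
        rw [mul_pow 2 (2 * (r * L))]; ring]
    exact mul_le_mul (pow_le_pow_left₀ (by positivity) (by nlinarith) n)
      (by nlinarith) (by positivity) (by positivity)
  have hI0 : ∀ l, 0 ≤ ∫ z in box n L T l, |u z| := fun l => integral_nonneg fun _ => abs_nonneg _
  have hJ1 : f (W⁻¹ * ∫ z in box n L T r, |u z|) ≤
      2 ^ (n + 1) * (W⁻¹ * ∫ z in box n L T r, f |u z|) := by
    have h1 : f (⨍ z in box n L T r, |u z|) ≤ ⨍ z in box n L T r, f |u z| :=
      hf.2.1.map_set_average_le hf.continuousOn isClosed_Ici (hne hVr0).1 (hne hVr0).2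
        (Eventually.of_forall fun z => mem_Ici.2 (abs_nonneg (u z)))
        ((hu1 ρ hρ).mono_set (hsub.trans hbox)).abs ((huf ρ hρ).mono_set (hsub.trans hbox))
    rw [setAverage_eq, setAverage_eq, smul_eq_mul, smul_eq_mul] at h1
    have h2 : W⁻¹ * ∫ z in box n L T r, |u z| ≤
        (volume.real (box n L T r))⁻¹ * ∫ z in box n L T r, |u z| :=
      mul_le_mul_of_nonneg_right (inv_anti₀ hVr0 hVrW) (hI0 r)
    have h3 : (volume.real (box n L T r))⁻¹ ≤ 2 ^ (n + 1) * W⁻¹ := by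
      rw [← div_eq_mul_inv, le_div_iff₀ hW0, inv_mul_le_iff₀ hVr0, mul_comm]
      exact hWVr
    have h0 : 0 ≤ W⁻¹ * ∫ z in box n L T r, |u z| := mul_nonneg (inv_nonneg.2 hW0.le) (hI0 r)
    refine (hf.1 (mem_Ici.2 h0) (mem_Ici.2 (h0.trans h2)) h2).trans (h1.trans ?_)
    rw [← mul_assoc]
    exact mul_le_mul_of_nonneg_right h3
      (integral_nonneg fun _ => hf.nonneg (abs_nonneg _))
  have hJ2 : W⁻¹ * ∫ z in box n L T s, |u z| ^ p ≤ (W⁻¹ * ∫ z in box n L T s, |u z|) ^ p := by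
    have h1 : (⨍ z in box n L T s, |u z| ^ p) ≤ (⨍ z in box n L T s, |u z|) ^ p :=
      (Real.concaveOn_rpow hp0.le hp1).le_map_set_average
        (continuousOn_id.rpow_const fun _ _ => Or.inr hp0.le) isClosed_Ici
        (hne hVs0).1 (hne hVs0).2
        (Eventually.of_forall fun z => mem_Ici.2 (abs_nonneg (u z)))
        ((hu1 ρ hρ).mono_set hbox).abs ((hup ρ hρ).mono_set hbox)
    rw [setAverage_eq, setAverage_eq, smul_eq_mul, smul_eq_mul] at h1
    set V := volume.real (box n L T s)
    set I := ∫ z in box n L T s, |u z|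
    have hc1 : 1 ≤ W / V := (one_le_div₀ hVs0).2 hVsW
    have h2 : (V⁻¹ * I) ^ p ≤ W / V * (W⁻¹ * I) ^ p := by
      rw [show V⁻¹ * I = W / V * (W⁻¹ * I) by field_simp,
        mul_rpow (by positivity) (mul_nonneg (inv_nonneg.2 hW0.le) (hI0 s))]
      refine mul_le_mul_of_nonneg_right ?_
        (rpow_nonneg (mul_nonneg (inv_nonneg.2 hW0.le) (hI0 s)) _)
      simpa using rpow_le_rpow_of_exponent_le hc1 hp1
    have h3 := mul_le_mul_of_nonneg_left (h1.trans h2) (show 0 ≤ V / W by positivity)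
    calc _ = V / W * (V⁻¹ * ∫ z in box n L T s, |u z| ^ p) := by field_simp
      _ ≤ _ := h3
      _ = _ := by field_simp
  have hJs0 : 0 ≤ W⁻¹ * ∫ z in box n L T s, |u z| := mul_nonneg (inv_nonneg.2 hW0.le) (hI0 s)
  set J := W⁻¹ * ∫ z in box n L T s, |u z| with hJ
  set x := (((s - r) * T)⁻¹) ^ k with hx
  set y := (((s - r) * L)⁻¹) ^ m with hy
  have hx0 : 0 ≤ x := by positivity
  have hy0 : 0 ≤ y := by positivity
  have hJp := rpow_nonneg hJs0 p
  have hE2 := mul_le_mul_of_nonneg_left hE (inv_nonneg.2 hW0.le)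
  set c : ℝ := ((mIdx n m).card : ℝ) * A with hc
  have hc0 : 0 ≤ c := by positivity
  have hK0 : 0 ≤ K ^ (n + 1) := by positivity
  have hE3 : W⁻¹ * ∫ z in box n L T r, f |u z| ≤ K ^ (n + 1) * x * J +
      c * K ^ (n + 1) * y * J ^ p := by
    refine hE2.trans ?_
    have := mul_le_mul_of_nonneg_left hJ2 (show 0 ≤ c * K ^ (n + 1) * y by positivity)
    calc _ = K ^ (n + 1) * x * J +
        c * K ^ (n + 1) * y * (W⁻¹ * ∫ z in box n L T s, |u z| ^ p) := by rw [hJ, hc]; ring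
      _ ≤ _ := by linarith
  refine hJ1.trans ((mul_le_mul_of_nonneg_left hE3 (by positivity)).trans ?_)
  have h1 : 0 ≤ K ^ (n + 1) * c * (x * J) := by positivity
  have h2 : 0 ≤ K ^ (n + 1) * (y * J ^ p) := by positivity
  have h3 : K ^ (n + 1) * x * J + c * K ^ (n + 1) * y * J ^ p ≤
      K ^ (n + 1) * ((1 + c) * (x * J + y * J ^ p)) := by linarith
  refine (mul_le_mul_of_nonneg_left h3 (by positivity)).trans (le_of_eq ?_)
  ring

lemma GoodF.continuousOn_weight {p : ℝ} {f : ℝ → ℝ} (hf : GoodF p f) (q d : ℝ) :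
    ContinuousOn (fun ζ : ℝ => ζ ^ (q - 1) / f ζ ^ d) (Ioi 0) := by
  refine (continuousOn_id.rpow_const fun ζ hζ => Or.inl (ne_of_gt hζ)).div
    ((hf.continuousOn.mono Ioi_subset_Ici_self).rpow_const fun ζ hζ =>
      Or.inl (hf.2.2.2.2 ζ hζ).ne') fun ζ hζ => (rpow_pos_of_pos (hf.2.2.2.2 ζ hζ) d).ne'

lemma GoodF.integrableOn_weight {p : ℝ} {f : ℝ → ℝ} (hf : GoodF p f) {q d : ℝ}
    (h : IntegrableOn (fun ζ : ℝ => ζ ^ (q - 1) / f ζ ^ d) (Ioi 1)) {z : ℝ} (hz : 0 < z) :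
    IntegrableOn (fun ζ : ℝ => ζ ^ (q - 1) / f ζ ^ d) (Ioi z) := by
  have h1 : IntegrableOn (fun ζ : ℝ => ζ ^ (q - 1) / f ζ ^ d) (Icc z 1) :=
    ((hf.continuousOn_weight q d).mono fun ζ hζ => hz.trans_le hζ.1).integrableOn_Icc
  refine (h1.union h).mono_set fun ζ hζ => ?_
  rcases le_or_gt ζ 1 with h2 | h2
  · exact Or.inl ⟨le_of_lt hζ, h2⟩
  · exact Or.inr h2

lemma GoodF.weight_nonneg {p : ℝ} {f : ℝ → ℝ} (hf : GoodF p f) (q d : ℝ) {ζ : ℝ} (hζ : 0 < ζ) :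
    0 ≤ ζ ^ (q - 1) / f ζ ^ d :=
  div_nonneg (rpow_nonneg hζ.le _) (rpow_nonneg (hf.2.2.2.2 ζ hζ).le _)

lemma GoodF.tail_nonneg {p : ℝ} {f : ℝ → ℝ} (hf : GoodF p f) (q d : ℝ) {z : ℝ} (hz : 0 < z) :
    0 ≤ ∫ ζ in Ioi z, ζ ^ (q - 1) / f ζ ^ d :=
  setIntegral_nonneg measurableSet_Ioi fun _ hζ => hf.weight_nonneg q d (hz.trans hζ)

lemma GoodF.antitoneOn_tail {p : ℝ} {f : ℝ → ℝ} (hf : GoodF p f) {q d : ℝ}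
    (h : IntegrableOn (fun ζ : ℝ => ζ ^ (q - 1) / f ζ ^ d) (Ioi 1)) :
    AntitoneOn (fun z => ∫ ζ in Ioi z, ζ ^ (q - 1) / f ζ ^ d) (Ioi 0) := by
  intro x hx y _ hxy
  refine setIntegral_mono_set (hf.integrableOn_weight h hx) ?_ (Ioi_subset_Ioi hxy).eventuallyLE
  exact ae_restrict_of_forall_mem measurableSet_Ioi fun ζ hζ =>
    hf.weight_nonneg q d (lt_trans hx hζ)

lemma GoodF.le_tail_sub_tail {p : ℝ} {f : ℝ → ℝ} (hf : GoodF p f) {q d : ℝ} (hq : q ≤ 1)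
    (hd : 0 ≤ d) (h : IntegrableOn (fun ζ : ℝ => ζ ^ (q - 1) / f ζ ^ d) (Ioi 1)) {z : ℝ}
    (hz : 0 < z) :
    z ^ q / f z ^ d ≤ 2 * ((∫ ζ in Ioi (z / 2), ζ ^ (q - 1) / f ζ ^ d) -
      ∫ ζ in Ioi z, ζ ^ (q - 1) / f ζ ^ d) := by
  have hz2 : 0 < z / 2 := half_pos hz
  have hint := hf.integrableOn_weight h hz2
  have hIoc : IntegrableOn (fun ζ : ℝ => ζ ^ (q - 1) / f ζ ^ d) (Ioc (z / 2) z) :=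
    hint.mono_set Ioc_subset_Ioi_self
  have e : ∫ ζ in Ioi (z / 2), ζ ^ (q - 1) / f ζ ^ d =
      (∫ ζ in Ioc (z / 2) z, ζ ^ (q - 1) / f ζ ^ d) +
        ∫ ζ in Ioi z, ζ ^ (q - 1) / f ζ ^ d := by
    rw [← setIntegral_union Ioc_disjoint_Ioi_same measurableSet_Ioi hIoc
      (hf.integrableOn_weight h hz), Ioc_union_Ioi_eq_Ioi (by linarith)]
  have hle : ∫ _ in Ioc (z / 2) z, z ^ (q - 1) / f z ^ d ≤
      ∫ ζ in Ioc (z / 2) z, ζ ^ (q - 1) / f ζ ^ d := by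
    refine setIntegral_mono_on (integrableOn_const (by simp)) hIoc measurableSet_Ioc
      fun ζ hζ => ?_
    have hζ0 : 0 < ζ := hz2.trans hζ.1
    have hfζ := hf.2.2.2.2 ζ hζ0
    refine div_le_div₀ (rpow_nonneg hζ0.le _)
      (rpow_le_rpow_of_nonpos hζ0 hζ.2 (by linarith)) (rpow_pos_of_pos hfζ d)
      (rpow_le_rpow hfζ.le (hf.1 (mem_Ici.2 hζ0.le) (mem_Ici.2 hz.le) hζ.2) hd)
  rw [setIntegral_const, Real.volume_real_Ioc_of_le (by linarith), smul_eq_mul] at hle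
  rw [e]
  have e2 : z ^ q = z ^ (q - 1) * z := by
    rw [rpow_sub_one hz.ne']
    field_simp
  rw [e2]
  have e3 : z ^ (q - 1) * z / f z ^ d = 2 * ((z - z / 2) * (z ^ (q - 1) / f z ^ d)) := by ring
  rw [e3]
  linarith

lemma le_rpow_inv_of_le_mul_inv_pow {k : ℕ} (hk : k ≠ 0) {x c y w : ℝ} (hx : 0 < x)
    (hc : 0 ≤ c) (hy : 0 ≤ y) (hw : 0 < w) (h : w ≤ c * (x⁻¹ ^ k * y)) :
    x ≤ c ^ ((k : ℝ)⁻¹) * (y ^ ((k : ℝ)⁻¹) / w ^ ((k : ℝ)⁻¹)) := by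
  have h1 : x ^ k ≤ c * (y / w) := by
    have hxk : 0 < x ^ k := pow_pos hx k
    rw [inv_pow] at h
    rw [← mul_div_assoc, le_div_iff₀ hw]
    calc x ^ k * w ≤ x ^ k * (c * ((x ^ k)⁻¹ * y)) := mul_le_mul_of_nonneg_left h hxk.le
      _ = c * y := by field_simp
  have h2 := rpow_le_rpow (pow_nonneg hx.le k) h1 (show (0 : ℝ) ≤ (k : ℝ)⁻¹ by positivity)
  rwa [pow_rpow_inv_natCast hx.le hk, mul_rpow hc (div_nonneg hy hw.le),
    div_rpow hy hw.le] at h2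

lemma one_le_tails {n k m : ℕ} (hk : 1 ≤ k) (hm : 1 ≤ m) {A p K : ℝ} (hA : 0 < A) (hp0 : 0 < p)
    (hp1 : p ≤ 1) (hK1 : 1 ≤ K)
    (hK : ∀ j ≤ max k m, ∀ a b s : ℝ, a < b →
      |iteratedDeriv j (cutoff a b) s| ≤ K * ((b - a)⁻¹) ^ j)
    {a : (Fin n → ℕ) → Spc n × ℝ → ℝ → ℝ} {f : ℝ → ℝ} {u0 : ℕ → Spc n → ℝ}
    {u : Spc n × ℝ → ℝ} (hS : Standing n k m A p a f u0) (hu : IsGlobalWeakSol n k m p a f u0 u)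
    {L T W D : ℝ} (hL : 0 < L) (hT : 0 < T) (hW : W = (4 * L) ^ n * (2 * T))
    (hD : D = 4 * (2 ^ (n + 1) * K ^ (n + 1) * (1 + (mIdx n m).card * A)))
    (hpos : 0 < ∫ z in box n L T 1, |u z|) :
    1 ≤ 2 * D ^ ((k : ℝ)⁻¹) / T *
        (∫ ζ in Ioi ((W⁻¹ * ∫ z in box n L T 1, |u z|) / 2),
          ζ ^ ((k : ℝ)⁻¹ - 1) / f ζ ^ ((k : ℝ)⁻¹)) +
      2 * D ^ ((m : ℝ)⁻¹) / L *
        ∫ ζ in Ioi ((W⁻¹ * ∫ z in box n L T 1, |u z|) / 2),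
          ζ ^ (p / (m : ℝ) - 1) / f ζ ^ ((m : ℝ)⁻¹) := by
  have hf := hS.2.1
  have h14 : Cond14 k f := hS.2.2.2.2.1
  have h15 : Cond15 m p f := hS.2.2.2.2.2
  have hW0 : 0 < W := by rw [hW]; positivity
  have hD0 : 0 < D := by rw [hD]; positivity
  have hk1 : (k : ℝ)⁻¹ ≤ 1 := inv_le_one_of_one_le₀ (by exact_mod_cast hk)
  have hm1 : p / (m : ℝ) ≤ 1 := div_le_one_of_le₀ (hp1.trans (by exact_mod_cast hm)) (by positivity)
  set a1 := 2 * D ^ ((k : ℝ)⁻¹) / T with ha1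
  set a2 := 2 * D ^ ((m : ℝ)⁻¹) / L with ha2
  have ha10 : 0 ≤ a1 := by positivity
  have ha20 : 0 ≤ a2 := by positivity
  set J : ℝ → ℝ := fun s => W⁻¹ * ∫ z in box n L T s, |u z| with hJ
  set Ψ : ℝ → ℝ := fun z => a1 * (∫ ζ in Ioi z, ζ ^ ((k : ℝ)⁻¹ - 1) / f ζ ^ ((k : ℝ)⁻¹)) +
    a2 * ∫ ζ in Ioi z, ζ ^ (p / (m : ℝ) - 1) / f ζ ^ ((m : ℝ)⁻¹) with hΨ
  have hJmono : MonotoneOn J (Icc 1 2) := by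
    intro r _ s _ hrs
    obtain ⟨ρ, hρ, hbox⟩ := exists_box_subset_cyl n L T s
    exact mul_le_mul_of_nonneg_left (setIntegral_mono_set ((hu.1 ρ hρ).mono_set hbox).abs
      (Eventually.of_forall fun _ => abs_nonneg _) (box_mono hL.le hT.le hrs).eventuallyLE)
      (inv_nonneg.2 hW0.le)
  have hJ1 : 0 < J 1 := mul_pos (inv_pos.2 hW0) hpos
  have key : (2 : ℝ) - 1 ≤ Ψ (J 1 / 2) := by
    refine le_of_doubling one_le_two hJmono hJ1 ?_ ?_ ?_
    · intro x hx y hy hxy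
      exact add_le_add (mul_le_mul_of_nonneg_left (hf.antitoneOn_tail h14 hx hy hxy) ha10)
        (mul_le_mul_of_nonneg_left (hf.antitoneOn_tail h15 hx hy hxy) ha20)
    · exact fun z hz => add_nonneg (mul_nonneg ha10 (hf.tail_nonneg _ _ hz))
        (mul_nonneg ha20 (hf.tail_nonneg _ _ hz))
    · intro r s hr hrs hs hdouble
      have hz : 0 < J r := hJ1.trans_le (hJmono ⟨le_rfl, one_le_two⟩ ⟨hr, by linarith⟩ hr)
      have hJs : 0 < J s := hz.trans_le (hJmono ⟨hr, by linarith⟩ ⟨by linarith, hs⟩ hrs.le)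
      have hfz := hf.2.2.2.2 _ hz
      have hd : 0 < s - r := sub_pos.2 hrs
      have hest : f (J r) ≤ _ :=
        average_estimate hk hA hp0 hp1 hK1 hK hS hu hL hT hW hr hrs hs
      have hJsp : J s ^ p ≤ 2 * J r ^ p := by
        refine (rpow_le_rpow hJs.le hdouble hp0.le).trans ?_
        rw [mul_rpow zero_le_two hz.le]
        refine mul_le_mul_of_nonneg_right ?_ (rpow_nonneg hz.le _)
        simpa using rpow_le_rpow_of_exponent_le one_le_two hp1
      have hest2 : f (J r) ≤ D / 4 * ((((s - r) * T)⁻¹) ^ k * (2 * J r) +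
          (((s - r) * L)⁻¹) ^ m * (2 * J r ^ p)) := by
        refine hest.trans ?_
        rw [show D / 4 = 2 ^ (n + 1) * K ^ (n + 1) * (1 + (mIdx n m).card * A) by rw [hD]; ring]
        refine mul_le_mul_of_nonneg_left (add_le_add ?_ ?_) (by positivity)
        · exact mul_le_mul_of_nonneg_left hdouble (by positivity)
        · exact mul_le_mul_of_nonneg_left hJsp (by positivity)
      have hT1 := hf.le_tail_sub_tail hk1 (by positivity) h14 hz
      have hT2 := hf.le_tail_sub_tail hm1 (by positivity) h15 hz
      have hanti1 := hf.antitoneOn_tail h14 (mem_Ioi.2 (half_pos hz)) (mem_Ioi.2 hz)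
        (half_le_self hz.le)
      have hanti2 := hf.antitoneOn_tail h15 (mem_Ioi.2 (half_pos hz)) (mem_Ioi.2 hz)
        (half_le_self hz.le)
      simp only at hanti1 hanti2
      have hsplit : f (J r) ≤ D * ((((s - r) * T)⁻¹) ^ k * J r) ∨
          f (J r) ≤ D * ((((s - r) * L)⁻¹) ^ m * J r ^ p) := by
        by_contra! hcon
        linarith [hcon.1, hcon.2]
      simp only [hΨ]
      set P1 := ∫ ζ in Ioi (J r / 2), ζ ^ ((k : ℝ)⁻¹ - 1) / f ζ ^ ((k : ℝ)⁻¹)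
      set P2 := ∫ ζ in Ioi (J r), ζ ^ ((k : ℝ)⁻¹ - 1) / f ζ ^ ((k : ℝ)⁻¹)
      set P3 := ∫ ζ in Ioi (J r / 2), ζ ^ (p / (m : ℝ) - 1) / f ζ ^ ((m : ℝ)⁻¹)
      set P4 := ∫ ζ in Ioi (J r), ζ ^ (p / (m : ℝ) - 1) / f ζ ^ ((m : ℝ)⁻¹)
      have hn1 : 0 ≤ a1 * (P1 - P2) := mul_nonneg ha10 (sub_nonneg.2 hanti1)
      have hn2 : 0 ≤ a2 * (P3 - P4) := mul_nonneg ha20 (sub_nonneg.2 hanti2)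
      rcases hsplit with h | h
      · have h1 := le_rpow_inv_of_le_mul_inv_pow (by omega) (mul_pos hd hT) hD0.le hz.le hfz h
        have h2 := h1.trans (mul_le_mul_of_nonneg_left hT1 (rpow_nonneg hD0.le _))
        have h3 : s - r ≤ a1 * (P1 - P2) := by
          rw [ha1, div_mul_eq_mul_div, le_div_iff₀ hT]
          linarith
        linarith
      · have h1 := le_rpow_inv_of_le_mul_inv_pow (by omega) (mul_pos hd hL) hD0.le
          (rpow_nonneg hz.le p) hfz h
        rw [← rpow_mul hz.le, ← div_eq_mul_inv] at h1
        have h2 := h1.trans (mul_le_mul_of_nonneg_left hT2 (rpow_nonneg hD0.le _))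
        have h3 : s - r ≤ a2 * (P3 - P4) := by
          rw [ha2, div_mul_eq_mul_div, le_div_iff₀ hL]
          linarith
        linarith
  have e : (2 : ℝ) - 1 = 1 := by norm_num
  rwa [e] at key

/-- **Lemma 3.5.** Let `0 < p < 1`. For every `κ > 0` there are `C, σ > 0`, depending
only on `A, k, m, n, p, κ`, such that for every global weak solution `u` and every
`R > 0` with `mes {(x,t) ∈ Q_R^κ : u ≠ 0} > 0`,
`F_κ(σ R^{-(n+κ)} ∫_{Q_R^κ} |u|) ≥ C R`. -/
theorem lemma_3_5
    (n k m : ℕ) (hn : 1 ≤ n) (hk : 1 ≤ k) (hm : 1 ≤ m)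
    (A p : ℝ) (hA : 0 < A) (hp0 : 0 < p) (hp1 : p < 1) (κ : ℝ) (hκ : 0 < κ) :
    ∃ C σ : ℝ, 0 < C ∧ 0 < σ ∧
      ∀ (a : (Fin n → ℕ) → Spc n × ℝ → ℝ → ℝ) (f : ℝ → ℝ) (u0 : ℕ → Spc n → ℝ)
        (u : Spc n × ℝ → ℝ), Standing n k m A p a f u0 →
        IsGlobalWeakSol n k m p a f u0 u →
        ∀ R : ℝ, 0 < R →
          0 < volume {z : Spc n × ℝ | z ∈ cyl n R κ ∧ u z ≠ 0} →
          C * R ≤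
            Fkappa k m p κ f
              (σ / R ^ ((n : ℝ) + κ) * ∫ z in cyl n R κ, |u z|) := by
  obtain ⟨K, hK1, hK⟩ := exists_iteratedDeriv_cutoff_bound (max k m)
  obtain ⟨D, hD⟩ : ∃ D : ℝ, D = 4 * (2 ^ (n + 1) * K ^ (n + 1) * (1 + (mIdx n m).card * A)) :=
    ⟨_, rfl⟩
  have hD0 : 0 < D := by rw [hD]; positivity
  have hD1 : 0 < 4 * D ^ ((k : ℝ)⁻¹) := by positivity
  have hD2 : 0 < 4 * D ^ ((m : ℝ)⁻¹) := by positivity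
  refine ⟨min (((4 * D ^ ((k : ℝ)⁻¹)) ^ κ⁻¹)⁻¹) ((4 * D ^ ((m : ℝ)⁻¹))⁻¹), 1 / (4 * 4 ^ n),
    lt_min (by positivity) (by positivity), by positivity, ?_⟩
  intro a f u0 u hS hu R hR hvol
  have hf := hS.2.1
  have h14 : Cond14 k f := hS.2.2.2.2.1
  have h15 : Cond15 m p f := hS.2.2.2.2.2
  have hT : 0 < R ^ κ := rpow_pos_of_pos hR κ
  obtain ⟨ρ, hρ, hbox⟩ := exists_box_subset_cyl n R (R ^ κ) 1
  have hbint : IntegrableOn (fun z => |u z|) (box n R (R ^ κ) 1) :=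
    ((hu.1 ρ hρ).mono_set hbox).abs
  have hQint : IntegrableOn (fun z => |u z|) (cyl n R κ) := hbint.mono_set cyl_subset_box
  have hQpos : 0 < ∫ z in cyl n R κ, |u z| := by
    rw [setIntegral_pos_iff_support_of_nonneg_ae (Eventually.of_forall fun _ => abs_nonneg _)
      hQint]
    refine hvol.trans_le (measure_mono fun z hz => ⟨?_, hz.1⟩)
    simpa using hz.2
  have hQB : ∫ z in cyl n R κ, |u z| ≤ ∫ z in box n R (R ^ κ) 1, |u z| :=
    setIntegral_mono_set hbint (Eventually.of_forall fun _ => abs_nonneg _)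
      cyl_subset_box.eventuallyLE
  have hkey := one_le_tails hk hm hA hp0 hp1.le hK1 hK hS hu hR hT rfl hD (hQpos.trans_le hQB)
  set B := ∫ z in box n R (R ^ κ) 1, |u z|
  set Q := ∫ z in cyl n R κ, |u z|
  have hRn : 0 < R ^ ((n : ℝ) + κ) := rpow_pos_of_pos hR _
  have e : ((4 * R) ^ n * (2 * R ^ κ))⁻¹ * B / 2 = 1 / (4 * 4 ^ n) / R ^ ((n : ℝ) + κ) * B := by
    rw [rpow_add hR, rpow_natCast, mul_pow]
    field_simp
    ring
  rw [e] at hkey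
  have hs' : 0 < 1 / (4 * 4 ^ n) / R ^ ((n : ℝ) + κ) * Q := by positivity
  have hle : 1 / (4 * 4 ^ n) / R ^ ((n : ℝ) + κ) * Q ≤ 1 / (4 * 4 ^ n) / R ^ ((n : ℝ) + κ) * B :=
    mul_le_mul_of_nonneg_left hQB (by positivity)
  set s1 := 1 / (4 * 4 ^ n) / R ^ ((n : ℝ) + κ) * Q
  set s0 := 1 / (4 * 4 ^ n) / R ^ ((n : ℝ) + κ) * B
  have ht1 := hf.antitoneOn_tail h14 (mem_Ioi.2 hs') (mem_Ioi.2 (hs'.trans_le hle)) hle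
  have ht2 := hf.antitoneOn_tail h15 (mem_Ioi.2 hs') (mem_Ioi.2 (hs'.trans_le hle)) hle
  have hn1 := hf.tail_nonneg ((k : ℝ)⁻¹) ((k : ℝ)⁻¹) hs'
  have hn2 := hf.tail_nonneg (p / (m : ℝ)) ((m : ℝ)⁻¹) hs'
  simp only at ht1 ht2
  rw [Fkappa]
  set P0 := ∫ ζ in Ioi s0, ζ ^ ((k : ℝ)⁻¹ - 1) / f ζ ^ ((k : ℝ)⁻¹)
  set P1 := ∫ ζ in Ioi s1, ζ ^ ((k : ℝ)⁻¹ - 1) / f ζ ^ ((k : ℝ)⁻¹)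
  set N0 := ∫ ζ in Ioi s0, ζ ^ (p / (m : ℝ) - 1) / f ζ ^ ((m : ℝ)⁻¹)
  set N1 := ∫ ζ in Ioi s1, ζ ^ (p / (m : ℝ) - 1) / f ζ ^ ((m : ℝ)⁻¹)
  have hP1κ : 0 ≤ P1 ^ κ⁻¹ := rpow_nonneg hn1 _
  have hsplit : 1 / 2 ≤ 2 * D ^ ((k : ℝ)⁻¹) / R ^ κ * P0 ∨
      1 / 2 ≤ 2 * D ^ ((m : ℝ)⁻¹) / R * N0 := by
    by_contra! hcon
    linarith [hcon.1, hcon.2]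
  rcases hsplit with h | h
  · rw [div_mul_eq_mul_div, le_div_iff₀ hT] at h
    have h1 : R ^ κ ≤ 4 * D ^ ((k : ℝ)⁻¹) * P1 := by
      have := mul_le_mul_of_nonneg_left ht1 hD1.le
      linarith
    have h2 := rpow_le_rpow hT.le h1 (inv_nonneg.2 hκ.le)
    rw [rpow_rpow_inv hR.le hκ.ne', mul_rpow hD1.le hn1] at h2
    have h3 : ((4 * D ^ ((k : ℝ)⁻¹)) ^ κ⁻¹)⁻¹ * R ≤ P1 ^ κ⁻¹ := by
      rw [inv_mul_le_iff₀ (by positivity)]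
      exact h2
    have h4 := mul_le_mul_of_nonneg_right
      (min_le_left (((4 * D ^ ((k : ℝ)⁻¹)) ^ κ⁻¹)⁻¹) ((4 * D ^ ((m : ℝ)⁻¹))⁻¹)) hR.le
    linarith
  · rw [div_mul_eq_mul_div, le_div_iff₀ hR] at h
    have h1 : R ≤ 4 * D ^ ((m : ℝ)⁻¹) * N1 := by
      have := mul_le_mul_of_nonneg_left ht2 hD2.le
      linarith
    have h3 : (4 * D ^ ((m : ℝ)⁻¹))⁻¹ * R ≤ N1 := by
      rw [inv_mul_le_iff₀ hD2]
      exact h1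
    have h4 := mul_le_mul_of_nonneg_right
      (min_le_right (((4 * D ^ ((k : ℝ)⁻¹)) ^ κ⁻¹)⁻¹) ((4 * D ^ ((m : ℝ)⁻¹))⁻¹)) hR.le
    linarith
end
end

section
/- Let p ≥ 1. For every κ > 0 there exists a constant C > 0, depending only on A, k, m, n, p and κ, such that for every global weak solution u of the problem and all R > 0 one has R^{−(kκ−m)} ( (mes(Q_R^κ \ Q_{R/2}^κ))^{−1} ∫_{Q_R^κ \ Q_{R/2}^κ} |u|^p dx dt )^{1/p} + (mes(Q_R^κ \ Q_{R/2}^κ))^{−1} ∫_{Q_R^κ \ Q_{R/2}^κ} |u|^p dx dt ≥ C R^{−(n+κ−m)} ∫_{Q_{R/2}^κ} f(|u|) dx dt. -/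
open MeasureTheory Real Set Filter

noncomputable section

/-- The anisotropic dilation `(x, t) ↦ (r x, s t)`. -/
def dilation (n : ℕ) (r s : ℝ) (z : Spc n × ℝ) : Spc n × ℝ := (r • z.1, s * z.2)

lemma contDiff_dilation (n : ℕ) (r s : ℝ) : ContDiff ℝ (⊤ : ℕ∞) (dilation n r s) := by
  unfold dilation
  fun_prop

section Scaling

variable {n : ℕ}

lemma spDeriv_const_mul_comp_dilation (i : Fin n) (c r s : ℝ) (g : Spc n × ℝ → ℝ) :
    spDeriv n i (fun z => c * g (dilation n r s z)) =
      fun z => c * r * spDeriv n i g (dilation n r s z) := by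
  funext z
  have h := deriv_comp_mul_left r
    (fun y : ℝ => g (r • z.1 + y • EuclideanSpace.single i (1 : ℝ), s * z.2)) 0
  simp only [mul_zero, smul_eq_mul] at h
  simp only [spDeriv, dilation, smul_add, smul_smul]
  rw [deriv_const_mul_field, h, mul_assoc]

lemma tDeriv_const_mul_comp_dilation (c r s : ℝ) (g : Spc n × ℝ → ℝ) :
    tDeriv n (fun z => c * g (dilation n r s z)) =
      fun z => c * s * tDeriv n g (dilation n r s z) := by
  funext z
  have h := deriv_comp_mul_left s (fun y : ℝ => g (r • z.1, y)) z.2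
  simp only [smul_eq_mul] at h
  simp only [tDeriv, dilation]
  rw [deriv_const_mul_field, h, mul_assoc]

lemma spDeriv_iterate_const_mul_comp_dilation (i : Fin n) (c r s : ℝ) (g : Spc n × ℝ → ℝ)
    (j : ℕ) :
    (spDeriv n i)^[j] (fun z => c * g (dilation n r s z)) =
      fun z => c * r ^ j * (spDeriv n i)^[j] g (dilation n r s z) := by
  induction j with
  | zero => simp
  | succ j ih =>
    simp only [Function.iterate_succ_apply', ih, spDeriv_const_mul_comp_dilation, pow_succ]
    simp only [mul_assoc]

lemma tDeriv_iterate_comp_dilation (r s : ℝ) (g : Spc n × ℝ → ℝ) (j : ℕ) :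
    (tDeriv n)^[j] (fun z => g (dilation n r s z)) =
      fun z => s ^ j * (tDeriv n)^[j] g (dilation n r s z) := by
  induction j with
  | zero => simp
  | succ j ih =>
    simp only [Function.iterate_succ_apply', ih, tDeriv_const_mul_comp_dilation, pow_succ]

lemma mDeriv_comp_dilation (α : Fin n → ℕ) (r s : ℝ) (g : Spc n × ℝ → ℝ) :
    mDeriv n α (fun z => g (dilation n r s z)) =
      fun z => r ^ (∑ i, α i) * mDeriv n α g (dilation n r s z) := by
  have key : ∀ l : List (Fin n),
      l.foldr (fun i ψ => (spDeriv n i)^[α i] ψ) (fun z => g (dilation n r s z)) =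
        fun z => r ^ (l.map α).sum *
          l.foldr (fun i ψ => (spDeriv n i)^[α i] ψ) g (dilation n r s z) := by
    intro l
    induction l with
    | nil => simp
    | cons i l ih =>
      simp only [List.foldr_cons, ih, spDeriv_iterate_const_mul_comp_dilation, List.map_cons,
        List.sum_cons, pow_add, mul_comm (r ^ α i)]
  have hsum : ((List.finRange n).map α).sum = ∑ i, α i := by
    rw [← List.ofFn_eq_map, List.sum_ofFn]
  simp only [mDeriv, key, hsum]

end Scaling

section Locality

variable {n : ℕ} {U : Set (Spc n × ℝ)} {g : Spc n × ℝ → ℝ} {c : ℝ}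

lemma spDeriv_eq_zero_of_const_on (hU : IsOpen U) (h : ∀ z ∈ U, g z = c) (i : Fin n) :
    ∀ z ∈ U, spDeriv n i g z = 0 := by
  intro z hz
  have hcont : ContinuousAt
      (fun s : ℝ => (z.1 + s • EuclideanSpace.single i (1 : ℝ), z.2)) 0 := by fun_prop
  have hev : (fun s : ℝ => g (z.1 + s • EuclideanSpace.single i (1 : ℝ), z.2)) =ᶠ[nhds 0]
      fun _ => c := by
    filter_upwards [hcont.preimage_mem_nhds (hU.mem_nhds (by simpa using hz))] with s hs
    exact h _ hs
  rw [spDeriv, hev.deriv_eq, deriv_const]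

lemma tDeriv_eq_zero_of_const_on (hU : IsOpen U) (h : ∀ z ∈ U, g z = c) :
    ∀ z ∈ U, tDeriv n g z = 0 := by
  intro z hz
  have hcont : ContinuousAt (fun s : ℝ => (z.1, s)) z.2 := by fun_prop
  have hev : (fun s : ℝ => g (z.1, s)) =ᶠ[nhds z.2] fun _ => c := by
    filter_upwards [hcont.preimage_mem_nhds (hU.mem_nhds (by simpa using hz))] with s hs
    exact h _ hs
  rw [tDeriv, hev.deriv_eq, deriv_const]

lemma tDeriv_iterate_eq_zero_on (hU : IsOpen U) (h : ∀ z ∈ U, g z = 0) (j : ℕ) :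
    ∀ z ∈ U, (tDeriv n)^[j] g z = 0 := by
  induction j with
  | zero => exact h
  | succ j ih =>
    rw [Function.iterate_succ_apply']
    exact tDeriv_eq_zero_of_const_on hU ih

lemma tDeriv_iterate_eq_zero_of_const_on (hU : IsOpen U) (h : ∀ z ∈ U, g z = c) {j : ℕ}
    (hj : j ≠ 0) : ∀ z ∈ U, (tDeriv n)^[j] g z = 0 := by
  obtain ⟨j, rfl⟩ := Nat.exists_eq_succ_of_ne_zero hj
  rw [Function.iterate_succ_apply]
  exact tDeriv_iterate_eq_zero_on hU (tDeriv_eq_zero_of_const_on hU h) j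

lemma spDeriv_iterate_const_on (hU : IsOpen U) (h : ∀ z ∈ U, g z = c) (i : Fin n) (j : ℕ) :
    ∀ z ∈ U, (spDeriv n i)^[j] g z = if j = 0 then c else 0 := by
  induction j with
  | zero => simpa using h
  | succ j ih =>
    rw [Function.iterate_succ_apply']
    simpa using spDeriv_eq_zero_of_const_on hU ih i

lemma mDeriv_eq_zero_of_const_on (hU : IsOpen U) (h : ∀ z ∈ U, g z = c) {α : Fin n → ℕ}
    (hα : ∑ i, α i ≠ 0) : ∀ z ∈ U, mDeriv n α g z = 0 := by
  have key : ∀ l : List (Fin n), ∃ d : ℝ,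
      (∀ z ∈ U, l.foldr (fun i ψ => (spDeriv n i)^[α i] ψ) g z = d) ∧
        (d = 0 ∨ ∀ i ∈ l, α i = 0) := by
    intro l
    induction l with
    | nil => exact ⟨c, h, Or.inr (by simp)⟩
    | cons i l ih =>
      obtain ⟨d, hd, hd'⟩ := ih
      refine ⟨_, spDeriv_iterate_const_on hU hd i (α i), ?_⟩
      by_cases hi : α i = 0
      · simpa [hi] using hd'
      · simp [hi]
  obtain ⟨d, hd, hd' | hd'⟩ := key (List.finRange n)
  · simpa only [mDeriv, hd'] using hd
  · exact absurd (Finset.sum_eq_zero fun i _ => hd' i (List.mem_finRange i)) hα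

end Locality

section Smoothness

variable {n : ℕ} {g : Spc n × ℝ → ℝ}

lemma contDiff_spDeriv (hg : ContDiff ℝ (⊤ : ℕ∞) g) (i : Fin n) :
    ContDiff ℝ (⊤ : ℕ∞) (spDeriv n i g) := by
  have h : spDeriv n i g = fun z => fderiv ℝ g z (EuclideanSpace.single i (1 : ℝ), 0) := by
    funext z
    have h1 : HasDerivAt (fun s : ℝ => (z.1 + s • EuclideanSpace.single i (1 : ℝ), z.2))
        (EuclideanSpace.single i (1 : ℝ), 0) 0 := by
      refine HasDerivAt.prodMk ?_ (hasDerivAt_const _ _)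
      simpa using ((hasDerivAt_id (0 : ℝ)).smul_const
        (EuclideanSpace.single i (1 : ℝ))).const_add z.1
    have h2 : HasFDerivAt g (fderiv ℝ g z)
        ((fun s : ℝ => (z.1 + s • EuclideanSpace.single i (1 : ℝ), z.2)) 0) := by
      simpa using (hg.differentiable (by simp) z).hasFDerivAt
    exact (h2.comp_hasDerivAt 0 h1).deriv
  rw [h]
  exact (hg.fderiv_right le_rfl).clm_apply contDiff_const

lemma contDiff_tDeriv (hg : ContDiff ℝ (⊤ : ℕ∞) g) : ContDiff ℝ (⊤ : ℕ∞) (tDeriv n g) := by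
  have h : tDeriv n g = fun z => fderiv ℝ g z (0, 1) := by
    funext z
    have h1 : HasDerivAt (fun s : ℝ => (z.1, s)) ((0 : Spc n), (1 : ℝ)) z.2 :=
      (hasDerivAt_const _ _).prodMk (hasDerivAt_id _)
    have h2 : HasFDerivAt g (fderiv ℝ g z) ((fun s : ℝ => (z.1, s)) z.2) :=
      (hg.differentiable (by simp) z).hasFDerivAt
    exact (h2.comp_hasDerivAt z.2 h1).deriv
  rw [h]
  exact (hg.fderiv_right le_rfl).clm_apply contDiff_const

lemma contDiff_tDeriv_iterate (hg : ContDiff ℝ (⊤ : ℕ∞) g) (j : ℕ) :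
    ContDiff ℝ (⊤ : ℕ∞) ((tDeriv n)^[j] g) := by
  induction j with
  | zero => exact hg
  | succ j ih =>
    rw [Function.iterate_succ_apply']
    exact contDiff_tDeriv ih

lemma contDiff_mDeriv (hg : ContDiff ℝ (⊤ : ℕ∞) g) (α : Fin n → ℕ) :
    ContDiff ℝ (⊤ : ℕ∞) (mDeriv n α g) := by
  have iter : ∀ (i : Fin n) (j : ℕ) (ψ : Spc n × ℝ → ℝ), ContDiff ℝ (⊤ : ℕ∞) ψ →
      ContDiff ℝ (⊤ : ℕ∞) ((spDeriv n i)^[j] ψ) := by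
    intro i j ψ hψ
    induction j with
    | zero => exact hψ
    | succ j ih =>
      rw [Function.iterate_succ_apply']
      exact contDiff_spDeriv ih i
  unfold mDeriv
  induction List.finRange n with
  | nil => exact hg
  | cons i l ih => exact iter i _ _ ih

end Smoothness

lemma exists_bound_of_eq_zero_off_isCompact {X : Type*} [TopologicalSpace X] {K : Set X}
    (hK : IsCompact K) {g : X → ℝ} (hg : Continuous g) (h0 : ∀ z ∉ K, g z = 0) :
    ∃ M : ℝ, 0 ≤ M ∧ ∀ z, |g z| ≤ M := by
  obtain ⟨M, hM⟩ := hK.exists_bound_of_continuousOn hg.continuousOn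
  refine ⟨max M 0, le_max_right _ _, fun z => ?_⟩
  by_cases hz : z ∈ K
  · exact (hM z hz).trans (le_max_left _ _)
  · simp [h0 z hz]

/-- A cutoff equal to `1` on `Q_{1/2}^κ`, constant in time near the initial hyperplane, and
vanishing on the rest of the half-space outside `Q_1^κ`, with bounded derivatives living on
`Q_1^κ \ Q_{1/2}^κ`. -/
lemma exists_unit_cutoff (n k m : ℕ) (hk : 1 ≤ k) (hm : 1 ≤ m) (κ : ℝ) (hκ : 0 < κ) :
    ∃ (Φ : Spc n × ℝ → ℝ) (M : ℝ), 0 ≤ M ∧ ContDiff ℝ (⊤ : ℕ∞) Φ ∧ HasCompactSupport Φ ∧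
      (∀ z, 0 ≤ Φ z) ∧ (∀ z, Φ z ≤ 1) ∧
      (∀ z ∈ cyl n (1 / 2) κ, Φ z = 1) ∧
      (∀ z, 0 < z.2 → z ∉ cyl n 1 κ → Φ z = 0) ∧
      (∀ i ≠ 0, ∀ x, (tDeriv n)^[i] Φ (x, 0) = 0) ∧
      (∀ z, |(tDeriv n)^[k] Φ z| ≤ M) ∧
      (∀ z, 0 < z.2 → z ∉ cyl n 1 κ \ cyl n (1 / 2) κ → (tDeriv n)^[k] Φ z = 0) ∧
      (∀ α ∈ mIdx n m, ∀ z, |mDeriv n α Φ z| ≤ M) ∧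
      (∀ α ∈ mIdx n m, ∀ z, 0 < z.2 → z ∉ cyl n 1 κ \ cyl n (1 / 2) κ →
        mDeriv n α Φ z = 0) := by
  have hb0 : (0 : ℝ) < (1 / 2 : ℝ) ^ κ := by positivity
  have hb1 : (1 / 2 : ℝ) ^ κ < 1 := Real.rpow_lt_one (by norm_num) (by norm_num) hκ
  let ψ : ContDiffBump (0 : Spc n) := ⟨1 / 2, 3 / 4, by norm_num, by norm_num⟩
  let χ : ContDiffBump (0 : ℝ) :=
    ⟨(1 / 2 : ℝ) ^ κ, ((1 / 2 : ℝ) ^ κ + 1) / 2, hb0, by linarith⟩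
  let Φ : Spc n × ℝ → ℝ := fun z => ψ z.1 * χ z.2
  let K : Set (Spc n × ℝ) :=
    Metric.closedBall 0 (3 / 4) ×ˢ Metric.closedBall 0 (((1 / 2 : ℝ) ^ κ + 1) / 2)
  have hK : IsCompact K := (isCompact_closedBall _ _).prod (isCompact_closedBall _ _)
  have hΦ : ContDiff ℝ (⊤ : ℕ∞) Φ :=
    (ψ.contDiff.comp contDiff_fst).mul (χ.contDiff.comp contDiff_snd)
  have hΦK : ∀ z ∈ Kᶜ, Φ z = 0 := by
    intro z hz
    by_cases h1 : z.1 ∈ Metric.closedBall (0 : Spc n) (3 / 4)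
    · have h2 : z.2 ∉ Metric.closedBall (0 : ℝ) (((1 / 2 : ℝ) ^ κ + 1) / 2) :=
        fun h2 => hz ⟨h1, h2⟩
      have : χ z.2 = 0 := χ.zero_of_le_dist (not_le.1 fun h => h2 h).le
      simp [Φ, this]
    · have : ψ z.1 = 0 := ψ.zero_of_le_dist (not_le.1 fun h => h1 h).le
      simp [Φ, this]
  have hKo : IsOpen Kᶜ := hK.isClosed.isOpen_compl
  have hKcyl : ∀ z : Spc n × ℝ, 0 < z.2 → z ∉ cyl n 1 κ → z ∈ Kᶜ := by
    rintro ⟨x, t⟩ ht hz ⟨h1, h2⟩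
    refine hz ⟨?_, ht, ?_⟩
    · simp only [Metric.mem_closedBall, ball0, Metric.mem_ball] at h1 ⊢
      linarith
    · simp only [Metric.mem_closedBall, dist_zero_right, Real.norm_eq_abs] at h2
      rw [Real.one_rpow]
      have := le_abs_self t
      simp only
      linarith
  have hcylo : IsOpen (cyl n (1 / 2) κ) := Metric.isOpen_ball.prod isOpen_Ioo
  have hΦ1 : ∀ z ∈ cyl n (1 / 2) κ, Φ z = 1 := by
    rintro ⟨x, t⟩ ⟨h1, h2, h3⟩
    have e1 : ψ x = 1 := ψ.one_of_mem_closedBall (Metric.ball_subset_closedBall h1)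
    have e2 : χ t = 1 := χ.one_of_mem_closedBall (by
      simp only [Metric.mem_closedBall, dist_zero_right, Real.norm_eq_abs]
      rw [abs_of_pos h2]
      exact h3.le)
    simp [Φ, e1, e2]
  have hmα : ∀ α ∈ mIdx n m, ∑ i, α i ≠ 0 := by
    intro α hα
    rw [(Finset.mem_filter.1 hα).2]
    lia
  have ht0 := tDeriv_iterate_eq_zero_on hKo hΦK k
  have hm0 : ∀ α ∈ mIdx n m, ∀ z ∈ Kᶜ, mDeriv n α Φ z = 0 := fun α hα =>
    mDeriv_eq_zero_of_const_on hKo hΦK (hmα α hα)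
  obtain ⟨M₀, hM₀, hM₀b⟩ := exists_bound_of_eq_zero_off_isCompact hK
    (contDiff_tDeriv_iterate hΦ k).continuous ht0
  have hex : ∀ α : Fin n → ℕ, ∃ M : ℝ, 0 ≤ M ∧ (α ∈ mIdx n m → ∀ z, |mDeriv n α Φ z| ≤ M) := by
    intro α
    by_cases hα : α ∈ mIdx n m
    · obtain ⟨M, h, h'⟩ := exists_bound_of_eq_zero_off_isCompact hK
        (contDiff_mDeriv hΦ α).continuous (hm0 α hα)
      exact ⟨M, h, fun _ => h'⟩
    · exact ⟨0, le_rfl, fun h => absurd h hα⟩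
  choose B hB hBb using hex
  have hsum : 0 ≤ ∑ α ∈ mIdx n m, B α := Finset.sum_nonneg fun α _ => hB α
  refine ⟨Φ, M₀ + ∑ α ∈ mIdx n m, B α, by positivity, hΦ,
    HasCompactSupport.intro hK hΦK, fun z => mul_nonneg ψ.nonneg χ.nonneg,
    fun z => mul_le_one₀ ψ.le_one χ.nonneg χ.le_one, hΦ1,
    fun z hz hz' => hΦK z (hKcyl z hz hz'), ?_, fun z => (hM₀b z).trans (by linarith), ?_,
    fun α hα z => ?_, ?_⟩
  · intro i hi x
    obtain ⟨i, rfl⟩ := Nat.exists_eq_succ_of_ne_zero hi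
    have hW : IsOpen (univ ×ˢ Metric.ball 0 ((1 / 2 : ℝ) ^ κ) : Set (Spc n × ℝ)) :=
      isOpen_univ.prod Metric.isOpen_ball
    rw [Function.iterate_succ_apply]
    refine tDeriv_iterate_eq_zero_on hW ?_ i (x, 0) ⟨mem_univ _, Metric.mem_ball_self hb0⟩
    rintro ⟨y, t⟩ ⟨-, ht⟩
    have hev : (fun s : ℝ => Φ (y, s)) =ᶠ[nhds t] fun _ => ψ y := by
      filter_upwards [Metric.isOpen_ball.mem_nhds ht] with s hs
      have : χ s = 1 := χ.one_of_mem_closedBall (Metric.ball_subset_closedBall hs)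
      simp [Φ, this]
    simp only [tDeriv, hev.deriv_eq, deriv_const]
  · intro z hz hz'
    by_cases h : z ∈ cyl n (1 / 2) κ
    · exact tDeriv_iterate_eq_zero_of_const_on hcylo hΦ1 (by lia) z h
    · exact ht0 z (hKcyl z hz fun h' => hz' ⟨h', h⟩)
  · have := Finset.single_le_sum (f := B) (fun α _ => hB α) hα
    exact (hBb α hα z).trans (by linarith)
  · intro α hα z hz hz'
    by_cases h : z ∈ cyl n (1 / 2) κ
    · exact mDeriv_eq_zero_of_const_on hcylo hΦ1 (hmα α hα) z h
    · exact hm0 α hα z (hKcyl z hz fun h' => hz' ⟨h', h⟩)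

lemma cyl_subset_halfSp (n : ℕ) (r κ : ℝ) : cyl n r κ ⊆ halfSp n := fun _ hz => hz.2.1

lemma measurableSet_cyl (n : ℕ) (r κ : ℝ) : MeasurableSet (cyl n r κ) :=
  measurableSet_ball.prod measurableSet_Ioo

lemma dilation_mem_cyl_iff {n : ℕ} {κ R ρ : ℝ} (hR : 0 < R) (hρ : 0 ≤ ρ) (z : Spc n × ℝ) :
    dilation n R⁻¹ (R ^ κ)⁻¹ z ∈ cyl n ρ κ ↔ z ∈ cyl n (ρ * R) κ := by
  have hRκ : 0 < R ^ κ := Real.rpow_pos_of_pos hR κ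
  simp only [dilation, cyl, ball0, mem_prod, Metric.mem_ball, dist_zero_right, norm_smul,
    norm_inv, Real.norm_of_nonneg hR.le, mem_Ioo, Real.mul_rpow hρ hR.le]
  rw [inv_mul_lt_iff₀ hR, inv_mul_lt_iff₀ hRκ, mul_comm R, mul_comm (R ^ κ),
    mul_pos_iff_of_pos_left (inv_pos.2 hRκ)]

/-- Cutoffs for the cylinders `Q_R^κ`, with derivative bounds uniform in `R`. -/
lemma exists_cutoff (n k m : ℕ) (hk : 1 ≤ k) (hm : 1 ≤ m) (κ : ℝ) (hκ : 0 < κ) :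
    ∃ M : ℝ, 0 ≤ M ∧ ∀ R : ℝ, 0 < R → ∃ φ : Spc n × ℝ → ℝ,
      ContDiff ℝ (⊤ : ℕ∞) φ ∧ HasCompactSupport φ ∧ (∀ z, 0 ≤ φ z) ∧ (∀ z, φ z ≤ 1) ∧
      (∀ z ∈ cyl n (R / 2) κ, φ z = 1) ∧
      (∀ z ∈ halfSp n, z ∉ cyl n R κ → φ z = 0) ∧
      (∀ i ≠ 0, ∀ x, (tDeriv n)^[i] φ (x, 0) = 0) ∧
      (∀ z ∈ halfSp n, |(tDeriv n)^[k] φ z| ≤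
        (cyl n R κ \ cyl n (R / 2) κ).indicator (fun _ => M * ((R ^ κ)⁻¹) ^ k) z) ∧
      (∀ α ∈ mIdx n m, ∀ z ∈ halfSp n, |mDeriv n α φ z| ≤
        (cyl n R κ \ cyl n (R / 2) κ).indicator (fun _ => M * R⁻¹ ^ m) z) := by
  obtain ⟨Φ, M, hM, hΦ, hc, h0, h1, hone, hzero, hinit, htb, htz, hmb, hmz⟩ :=
    exists_unit_cutoff n k m hk hm κ hκ
  refine ⟨M, hM, fun R hR => ?_⟩
  have hRκ : 0 < R ^ κ := Real.rpow_pos_of_pos hR κ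
  have hdil1 : ∀ z : Spc n × ℝ, dilation n R⁻¹ (R ^ κ)⁻¹ z ∈ cyl n 1 κ ↔ z ∈ cyl n R κ := by
    intro z
    rw [dilation_mem_cyl_iff hR zero_le_one, one_mul]
  have hdil2 : ∀ z : Spc n × ℝ,
      dilation n R⁻¹ (R ^ κ)⁻¹ z ∈ cyl n (1 / 2) κ ↔ z ∈ cyl n (R / 2) κ := by
    intro z
    rw [dilation_mem_cyl_iff hR (by norm_num), one_div_mul_eq_div]
  have hpos : ∀ z ∈ halfSp n, 0 < (dilation n R⁻¹ (R ^ κ)⁻¹ z).2 := fun z hz =>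
    mul_pos (inv_pos.2 hRκ) hz
  have hmem : ∀ z, z ∉ cyl n R κ \ cyl n (R / 2) κ →
      dilation n R⁻¹ (R ^ κ)⁻¹ z ∉ cyl n 1 κ \ cyl n (1 / 2) κ := by
    intro z hz
    rwa [Set.mem_sdiff, hdil1, hdil2]
  refine ⟨fun z => Φ (dilation n R⁻¹ (R ^ κ)⁻¹ z), hΦ.comp (contDiff_dilation n _ _),
    hc.comp_homeomorph ((Homeomorph.smulOfNeZero R⁻¹ (inv_ne_zero hR.ne')).prodCongr
      (Homeomorph.mulLeft₀ (R ^ κ)⁻¹ (inv_ne_zero hRκ.ne'))),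
    fun z => h0 _, fun z => h1 _, fun z hz => hone _ ((hdil2 z).2 hz),
    fun z hz hz' => hzero _ (hpos z hz) (mt (hdil1 z).1 hz'), fun i hi x => ?_,
    fun z hz => ?_, fun α hα z hz => ?_⟩
  · rw [tDeriv_iterate_comp_dilation]
    simp only [dilation, mul_zero, hinit i hi]
  · simp only [tDeriv_iterate_comp_dilation]
    by_cases hD : z ∈ cyl n R κ \ cyl n (R / 2) κ
    · rw [indicator_of_mem hD, abs_mul, abs_of_nonneg (by positivity), mul_comm]
      gcongr
      exact htb _
    · rw [indicator_of_notMem hD, htz _ (hpos z hz) (hmem z hD)]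
      simp
  · simp only [mDeriv_comp_dilation, (Finset.mem_filter.1 hα).2]
    by_cases hD : z ∈ cyl n R κ \ cyl n (R / 2) κ
    · rw [indicator_of_mem hD, abs_mul, abs_of_nonneg (by positivity), mul_comm]
      gcongr
      exact hmb α hα _
    · rw [indicator_of_notMem hD, hmz α hα _ (hpos z hz) (hmem z hD)]
      simp

lemma integrableOn_cyl_of_forall {n : ℕ} {g : Spc n × ℝ → ℝ}
    (h : ∀ r : ℝ, 0 < r → IntegrableOn g (cyl n r 1)) {R : ℝ} (hR : 0 < R) (κ : ℝ) :
    IntegrableOn g (cyl n R κ) := by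
  refine (h (max R (R ^ κ)) (lt_max_of_lt_left hR)).mono_set ?_
  refine prod_mono (Metric.ball_subset_ball (le_max_left _ _)) (Ioo_subset_Ioo_right ?_)
  rw [Real.rpow_one]
  exact le_max_right _ _

/-- Testing the inequality with a cutoff bounds `∫ f(|u|)` on the inner cylinder by integrals
over the region where the derivatives of the cutoff live. -/
lemma integral_f_le_of_cutoff {n k m : ℕ} (hk : 1 ≤ k) {A p : ℝ} (hA : 0 < A)
    {a : (Fin n → ℕ) → Spc n × ℝ → ℝ → ℝ} {f : ℝ → ℝ} {u0 : ℕ → Spc n → ℝ}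
    {u : Spc n × ℝ → ℝ} (hS : Standing n k m A p a f u0)
    (hu : IsGlobalWeakSol n k m p a f u0 u) {R κ T X : ℝ} (hR : 0 < R)
    {φ : Spc n × ℝ → ℝ} (hφ : ContDiff ℝ (⊤ : ℕ∞) φ) (hc : HasCompactSupport φ)
    (h0 : ∀ z, 0 ≤ φ z) (h1 : ∀ z, φ z ≤ 1) (hone : ∀ z ∈ cyl n (R / 2) κ, φ z = 1)
    (hzero : ∀ z ∈ halfSp n, z ∉ cyl n R κ → φ z = 0)
    (hinit : ∀ i ≠ 0, ∀ x, (tDeriv n)^[i] φ (x, 0) = 0)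
    (ht : ∀ z ∈ halfSp n, |(tDeriv n)^[k] φ z| ≤
      (cyl n R κ \ cyl n (R / 2) κ).indicator (fun _ => T) z)
    (hx : ∀ α ∈ mIdx n m, ∀ z ∈ halfSp n, |mDeriv n α φ z| ≤
      (cyl n R κ \ cyl n (R / 2) κ).indicator (fun _ => X) z) :
    ∫ z in cyl n (R / 2) κ, f |u z| ≤
      T * (∫ z in cyl n R κ \ cyl n (R / 2) κ, |u z|) +
        (mIdx n m).card * A * X * ∫ z in cyl n R κ \ cyl n (R / 2) κ, |u z| ^ p := by
  obtain ⟨ha, hf, -, hu0, -, -⟩ := hS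
  obtain ⟨hu1, hup, hfu, hweak⟩ := hu
  have hw := hweak φ hφ hc h0
  have hRκ2 : cyl n (R / 2) κ ⊆ halfSp n := cyl_subset_halfSp n _ κ
  set D := cyl n R κ \ cyl n (R / 2) κ with hD
  have hDm : MeasurableSet D := (measurableSet_cyl n R κ).diff (measurableSet_cyl n _ κ)
  have hDH : D ⊆ halfSp n := sdiff_subset.trans (cyl_subset_halfSp n R κ)
  have hDu : IntegrableOn (fun z => |u z|) D :=
    ((integrableOn_cyl_of_forall hu1 hR κ).mono_set sdiff_subset).abs
  have hDup : IntegrableOn (fun z => |u z| ^ p) D :=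
    (integrableOn_cyl_of_forall hup hR κ).mono_set sdiff_subset
  have hind : ∀ (g : Spc n × ℝ → ℝ) (c : ℝ), IntegrableOn g D →
      IntegrableOn (D.indicator fun z => c * g z) (halfSp n) ∧
        ∫ z in halfSp n, D.indicator (fun z => c * g z) z = c * ∫ z in D, g z := by
    intro g c hg
    refine ⟨(IntegrableOn.integrable_indicator (hg.const_mul c) hDm).integrableOn, ?_⟩
    rw [setIntegral_indicator hDm, inter_eq_self_of_subset_right hDH, integral_const_mul]
  have htime : ∫ z in halfSp n, (-1 : ℝ) ^ k * u z * (tDeriv n)^[k] φ z ≤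
      T * ∫ z in D, |u z| := by
    obtain ⟨hi, he⟩ := hind (fun z => |u z|) T hDu
    rw [← he]
    refine (Real.le_norm_self _).trans (norm_integral_le_of_norm_le hi ?_)
    filter_upwards [ae_restrict_mem (measurableSet_halfSp n)] with z hz
    have h := ht z hz
    by_cases hzD : z ∈ D
    · simp only [indicator_of_mem hzD, norm_mul, norm_pow, norm_neg, norm_one, one_pow, one_mul,
        Real.norm_eq_abs] at h ⊢
      rw [mul_comm]
      gcongr
    · simp only [indicator_of_notMem hzD] at h ⊢
      simp [abs_nonpos_iff.1 h]
  have hspace : -(∫ z in halfSp n,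
        ∑ α ∈ mIdx n m, (-1 : ℝ) ^ m * a α z (u z) * mDeriv n α φ z) ≤
      (mIdx n m).card * A * X * ∫ z in D, |u z| ^ p := by
    obtain ⟨hi, he⟩ := hind (fun z => |u z| ^ p) ((mIdx n m).card * A * X) hDup
    rw [← he]
    rw [← integral_neg]
    refine (Real.le_norm_self _).trans (norm_integral_le_of_norm_le hi ?_)
    simp only [norm_neg]
    have hbound : ∀ᵐ z ∂(volume.restrict (halfSp n)), ∀ α ∈ mIdx n m,
        ∀ ζ : ℝ, |a α z ζ| ≤ A * |ζ| ^ p :=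
      (ae_ball_iff (mIdx n m).countable_toSet).2 fun α hα => (ha α hα).2.2
    filter_upwards [ae_restrict_mem (measurableSet_halfSp n), hbound] with z hz hb
    by_cases hzD : z ∈ D
    · rw [indicator_of_mem hzD]
      have hterm : ∀ α ∈ mIdx n m,
          ‖(-1 : ℝ) ^ m * a α z (u z) * mDeriv n α φ z‖ ≤ A * |u z| ^ p * X := by
        intro α hα
        have h := hx α hα z hz
        have h' := hb α hα (u z)
        simp only [indicator_of_mem hzD, norm_mul, norm_pow, norm_neg, norm_one, one_pow,
          one_mul, Real.norm_eq_abs] at h ⊢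
        gcongr
      refine (norm_sum_le_of_le _ hterm).trans (le_of_eq ?_)
      rw [Finset.sum_const, nsmul_eq_mul]
      ring
    · rw [indicator_of_notMem hzD, norm_le_zero_iff]
      refine Finset.sum_eq_zero fun α hα => ?_
      have h := hx α hα z hz
      rw [indicator_of_notMem hzD] at h
      simp [abs_nonpos_iff.1 h]
  have hdata : 0 ≤ ∫ x : Spc n, ∑ i ∈ Finset.range k,
      (-1 : ℝ) ^ i * u0 (k - 1 - i) x * (tDeriv n)^[i] φ (x, 0) := by
    refine integral_nonneg_of_ae ?_
    filter_upwards [hu0] with x hx0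
    rw [Finset.sum_eq_single 0 (fun i _ hi => by simp [hinit i hi])
      (fun h => absurd (Finset.mem_range.2 hk) h)]
    simpa using mul_nonneg hx0 (h0 (x, 0))
  have hsource : ∫ z in cyl n (R / 2) κ, f |u z| ≤ ∫ z in halfSp n, f |u z| * φ z := by
    have hfφ : IntegrableOn (fun z => f |u z| * φ z) (cyl n R κ) :=
      (integrableOn_cyl_of_forall hfu hR κ).mul_bdd (c := 1)
        hφ.continuous.aestronglyMeasurable
        (ae_of_all _ fun z => by rw [Real.norm_of_nonneg (h0 z)]; exact h1 z)
    have hfφ' : IntegrableOn (fun z => f |u z| * φ z) (halfSp n) :=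
      hfφ.of_forall_sdiff_eq_zero (measurableSet_halfSp n) fun z hz => by
        simp [hzero z hz.1 hz.2]
    calc ∫ z in cyl n (R / 2) κ, f |u z|
        = ∫ z in cyl n (R / 2) κ, f |u z| * φ z :=
          setIntegral_congr_fun (measurableSet_cyl n _ κ) fun z hz => by simp [hone z hz]
      _ ≤ ∫ z in halfSp n, f |u z| * φ z :=
          setIntegral_mono_set hfφ'
            (ae_of_all _ fun z => mul_nonneg (hf.nonneg (abs_nonneg _)) (h0 z))
            (ae_of_all _ hRκ2)
  linarith

/-- Hölder's inequality against the constant function `1`, in terms of averages. -/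
lemma integral_abs_le_measure_mul_rpow {X : Type*} [MeasurableSpace X] {μ : Measure X}
    {D : Set X} (hD : μ D ≠ ⊤) {p : ℝ} (hp : 1 ≤ p) {u : X → ℝ} (hu : IntegrableOn u D μ)
    (hup : IntegrableOn (fun z => |u z| ^ p) D μ) :
    ∫ z in D, |u z| ∂μ ≤
      (μ D).toReal * ((μ D).toReal⁻¹ * ∫ z in D, |u z| ^ p ∂μ) ^ (1 / p) := by
  by_cases h0 : μ D = 0
  · simp [Measure.restrict_eq_zero.2 h0, h0]
  have hpos : 0 < (μ D).toReal := ENNReal.toReal_pos h0 hD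
  have hJ := (convexOn_rpow hp).map_set_average_le
    (Real.continuous_rpow_const (by linarith)).continuousOn isClosed_Ici h0 hD
    (ae_of_all _ fun z => abs_nonneg (u z)) hu.abs hup
  simp only [setAverage_eq, smul_eq_mul, Measure.real] at hJ
  have hnn : 0 ≤ (μ D).toReal⁻¹ * ∫ z in D, |u z| ∂μ :=
    mul_nonneg (inv_nonneg.2 hpos.le) (integral_nonneg fun z => abs_nonneg _)
  have h := Real.rpow_le_rpow (Real.rpow_nonneg hnn p) hJ
    (show 0 ≤ 1 / p by positivity)
  rw [← Real.rpow_mul hnn, mul_one_div_cancel (by linarith), Real.rpow_one,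
    inv_mul_le_iff₀ hpos] at h
  exact h

lemma volume_cyl_toReal {n : ℕ} {R : ℝ} (hR : 0 < R) (κ : ℝ) :
    (volume (cyl n R κ)).toReal =
      R ^ ((n : ℝ) + κ) * (volume (ball0 n 1)).toReal := by
  rw [cyl, ball0, Measure.volume_eq_prod, Measure.prod_prod, ENNReal.toReal_mul,
    Real.volume_Ioo, sub_zero, ENNReal.toReal_ofReal (Real.rpow_pos_of_pos hR κ).le,
    Measure.addHaar_ball_of_pos _ _ hR, ENNReal.toReal_mul,
    ENNReal.toReal_ofReal (by positivity), finrank_euclideanSpace_fin, Real.rpow_add hR,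
    Real.rpow_natCast, ball0]
  ring

lemma volume_cyl_ne_top (n : ℕ) (R κ : ℝ) : volume (cyl n R κ) ≠ ⊤ := by
  rw [cyl, Measure.volume_eq_prod, Measure.prod_prod]
  exact ENNReal.mul_ne_top measure_ball_lt_top.ne measure_Ioo_lt_top.ne

/-- **Lemma 3.6.** Let `p ≥ 1`. For every `κ > 0` there is `C > 0`, depending only on
`A, k, m, n, p, κ`, such that for every global weak solution `u` and all `R > 0`,
`R^{-(kκ-m)} (avg |u|^p)^{1/p} + avg |u|^p ≥ C R^{-(n+κ-m)} ∫_{Q_{R/2}^κ} f(|u|)`,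
where the averages are over `Q_R^κ \ Q_{R/2}^κ`. -/
theorem lemma_3_6
    (n k m : ℕ) (hn : 1 ≤ n) (hk : 1 ≤ k) (hm : 1 ≤ m)
    (A p : ℝ) (hA : 0 < A) (hp : 1 ≤ p) (κ : ℝ) (hκ : 0 < κ) :
    ∃ C : ℝ, 0 < C ∧
      ∀ (a : (Fin n → ℕ) → Spc n × ℝ → ℝ → ℝ) (f : ℝ → ℝ) (u0 : ℕ → Spc n → ℝ)
        (u : Spc n × ℝ → ℝ), Standing n k m A p a f u0 →
        IsGlobalWeakSol n k m p a f u0 u →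
        ∀ R : ℝ, 0 < R → ∀ v : ℝ,
          v = (volume (cyl n R κ \ cyl n (R / 2) κ)).toReal⁻¹
              * ∫ z in cyl n R κ \ cyl n (R / 2) κ, |u z| ^ p →
          C * (R ^ (-((n : ℝ) + κ - (m : ℝ))) * ∫ z in cyl n (R / 2) κ, f |u z|) ≤
            R ^ (-((k : ℝ) * κ - (m : ℝ))) * v ^ (1 / p) + v := by
  obtain ⟨M, hM, hcut⟩ := exists_cutoff n k m hk hm κ hκ
  set ω := (volume (ball0 n 1)).toReal
  set N : ℝ := ((mIdx n m).card : ℝ)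
  have hω : 0 ≤ ω := ENNReal.toReal_nonneg
  have hN : 0 ≤ N := Nat.cast_nonneg _
  have hC : 0 < 1 + M * ω * (1 + N * A) := by positivity
  refine ⟨(1 + M * ω * (1 + N * A))⁻¹, inv_pos.2 hC, ?_⟩
  intro a f u0 u hS hu R hR v hv
  obtain ⟨φ, hφ, hc, h0, h1, hone, hzero, hinit, ht, hx⟩ := hcut R hR
  have hmain := integral_f_le_of_cutoff hk hA hS hu hR hφ hc h0 h1 hone hzero hinit ht hx
  set D := cyl n R κ \ cyl n (R / 2) κ
  have hDtop : volume D ≠ ⊤ := measure_ne_top_of_subset sdiff_subset (volume_cyl_ne_top n R κ)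
  have hDle : (volume D).toReal ≤ R ^ ((n : ℝ) + κ) * ω := by
    rw [← volume_cyl_toReal hR]
    exact ENNReal.toReal_mono (volume_cyl_ne_top n R κ) (measure_mono sdiff_subset)
  have hv0 : 0 ≤ v := by
    rw [hv]
    exact mul_nonneg (inv_nonneg.2 ENNReal.toReal_nonneg)
      (integral_nonneg fun z => Real.rpow_nonneg (abs_nonneg _) p)
  have hI1 : ∫ z in D, |u z| ≤ R ^ ((n : ℝ) + κ) * ω * v ^ (1 / p) := by
    have h := integral_abs_le_measure_mul_rpow hDtop hp
      ((integrableOn_cyl_of_forall hu.1 hR κ).mono_set sdiff_subset)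
      ((integrableOn_cyl_of_forall hu.2.1 hR κ).mono_set sdiff_subset)
    rw [← hv] at h
    exact h.trans (by gcongr)
  have hIp : ∫ z in D, |u z| ^ p ≤ R ^ ((n : ℝ) + κ) * ω * v := by
    have h : ∫ z in D, |u z| ^ p = (volume D).toReal * v := by
      rw [hv]
      by_cases hD0 : volume D = 0
      · simp [Measure.restrict_eq_zero.2 hD0, hD0]
      · rw [mul_inv_cancel_left₀ (ENNReal.toReal_pos hD0 hDtop).ne']
    rw [h]
    gcongr
  have hRκ : ((R ^ κ)⁻¹) ^ k = R ^ (-((k : ℝ) * κ)) := by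
    rw [← Real.rpow_neg hR.le, ← Real.rpow_natCast, ← Real.rpow_mul hR.le]
    ring_nf
  have hRm : R⁻¹ ^ m = R ^ (-(m : ℝ)) := by
    rw [Real.rpow_neg hR.le, Real.rpow_natCast, inv_pow]
  rw [hRκ, hRm] at hmain
  have hle : ∫ z in cyl n (R / 2) κ, f |u z| ≤
      M * R ^ (-((k : ℝ) * κ)) * (R ^ ((n : ℝ) + κ) * ω * v ^ (1 / p)) +
        N * A * (M * R ^ (-(m : ℝ))) * (R ^ ((n : ℝ) + κ) * ω * v) := by
    refine hmain.trans ?_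
    gcongr
  have e1 : R ^ (-((n : ℝ) + κ - m)) * R ^ (-((k : ℝ) * κ)) * R ^ ((n : ℝ) + κ) =
      R ^ (-((k : ℝ) * κ - m)) := by
    rw [← Real.rpow_add hR, ← Real.rpow_add hR]
    ring_nf
  have e2 : R ^ (-((n : ℝ) + κ - m)) * R ^ (-(m : ℝ)) * R ^ ((n : ℝ) + κ) = 1 := by
    rw [← Real.rpow_add hR, ← Real.rpow_add hR, ← Real.rpow_zero R]
    ring_nf
  have hX : 0 ≤ R ^ (-((k : ℝ) * κ - m)) * v ^ (1 / p) := by positivity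
  rw [inv_mul_le_iff₀ hC]
  calc R ^ (-((n : ℝ) + κ - m)) * ∫ z in cyl n (R / 2) κ, f |u z|
      ≤ R ^ (-((n : ℝ) + κ - m)) *
        (M * R ^ (-((k : ℝ) * κ)) * (R ^ ((n : ℝ) + κ) * ω * v ^ (1 / p)) +
          N * A * (M * R ^ (-(m : ℝ))) * (R ^ ((n : ℝ) + κ) * ω * v)) := by gcongr
    _ = M * ω * (R ^ (-((k : ℝ) * κ - m)) * v ^ (1 / p)) + M * ω * (N * A) * v := by
        rw [← e1]
        linear_combination M * ω * (N * A) * v * e2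
    _ ≤ (1 + M * ω * (1 + N * A)) * (R ^ (-((k : ℝ) * κ - m)) * v ^ (1 / p) + v) := by
        have : 0 ≤ M * ω * (N * A) * (R ^ (-((k : ℝ) * κ - m)) * v ^ (1 / p)) := by positivity
        have : 0 ≤ M * ω * v := by positivity
        linarith
end
end
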